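/- arXiv:2111.06528 — 6 statements merged into one kernel-verified Lean document; each statement's English description precedes it below -/
import Mathlib

section
/- There exists r > 0 such that for every x ∈ B(0,r) \ {0} one has H(x) > 0 and AH(x)/(2√(H(x))) − |σ(x)ᵀ∇H(x)|² / (8 H(x)^{3/2}) > 0; equivalently, 4 H(x) · AH(x) − |σ(x)ᵀ∇H(x)|² > 0 for all x ∈ B(0,r) \ {0}. -/
open MeasureTheory Matrix

noncomputable section

/-- Partial derivative of `f : ℝ² → ℝ` in the `i`-th coordinate direction. -/
def pd (i : Fin 2) (f : EuclideanSpace ℝ (Fin 2) → ℝ) :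
    EuclideanSpace ℝ (Fin 2) → ℝ :=
  fun x => fderiv ℝ f x (EuclideanSpace.single i 1)

open Asymptotics Filter Topology in
/-- Second-order Taylor expansion at a critical zero. -/
theorem isLittleO_sub_half_fderiv_fderiv {E : Type*} [NormedAddCommGroup E] [NormedSpace ℝ E]
    {f : E → ℝ} (hf : ContDiff ℝ 2 f) (hf0 : f 0 = 0) (hf' : fderiv ℝ f 0 = 0) :
    (fun x => f x - (1 / 2) * fderiv ℝ (fderiv ℝ f) 0 x x) =o[𝓝 0] fun x => ‖x‖ ^ 2 := by
  set D := fderiv ℝ (fderiv ℝ f) 0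
  have hsymm : ∀ v w, D v w = D w v := fun v w =>
    (hf.contDiffAt.isSymmSndFDerivAt (x := 0) (by simp)).eq v w
  have hfd : Differentiable ℝ f := hf.differentiable (by norm_num)
  have hd : HasFDerivAt (fderiv ℝ f) D 0 :=
    ((hf.fderiv_right (m := 1) (by norm_num)).differentiable (by norm_num) 0).hasFDerivAt
  have hder : ∀ x, HasFDerivAt (fun x => f x - (1 / 2) * D x x) (fderiv ℝ f x - D x) x := by
    intro x
    have h1 : HasFDerivAt (fun x => D x x) _ x := D.hasFDerivAt.clm_apply (hasFDerivAt_id x)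
    refine ((hfd x).hasFDerivAt.sub (h1.const_mul (1 / 2))).congr_fderiv ?_
    ext v
    simp [hsymm v x]
    ring
  have ho : (fun x => fderiv ℝ f x - D x) =o[𝓝 0] fun x : E => ‖x‖ ^ 1 := by
    have := hd.isLittleO
    simpa [hf'] using this.norm_right
  have := convex_univ.isLittleO_pow_succ (x₀ := (0 : E)) (n := 1) (Set.mem_univ _)
    (fun x _ => (hder x).hasFDerivWithinAt) (by simpa using ho)
  simpa [hf0] using this

open Asymptotics Filter in
/-- Products of leading-order approximations are approximated to leading order. -/
theorem isLittleO_mul_sub_mul {α : Type*} {L : Filter α} {f f₀ g g₀ k l : α → ℝ}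
    (hf : (fun x => f x - f₀ x) =o[L] k) (hf₀ : f₀ =O[L] k)
    (hg : (fun x => g x - g₀ x) =o[L] l) (hg₀ : g₀ =O[L] l) :
    (fun x => f x * g x - f₀ x * g₀ x) =o[L] fun x => k x * l x := by
  have hgl : g =O[L] l := by simpa using hg.isBigO.add hg₀
  refine ((hf.mul_isBigO hgl).add (hf₀.mul_isLittleO hg)).congr_left fun x => ?_
  ring

open Asymptotics Filter in
/-- Leading-order expansion of `2 f ⟨a, h⟩ - ⟨a g, g⟩`. -/
theorem isLittleO_drift_sub {α ι : Type*} [Fintype ι] {L : Filter α} {n : α → ℝ}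
    {f f₀ : α → ℝ} {g g₀ : ι → α → ℝ} {a h : ι → ι → α → ℝ} {q : ι → ι → ℝ}
    (ha : ∀ i j, a i j =O[L] fun _ => (1 : ℝ))
    (hh : ∀ i j, (fun x => h i j x - q i j) =o[L] fun _ => (1 : ℝ))
    (hg : ∀ i, (fun x => g i x - g₀ i x) =o[L] n) (hg₀ : ∀ i, g₀ i =O[L] n)
    (hf : (fun x => f x - f₀ x) =o[L] fun x => n x ^ 2) (hf₀ : f₀ =O[L] fun x => n x ^ 2) :
    (fun x => (2 * (f x * ∑ i, ∑ j, a i j x * h i j x) - ∑ i, ∑ j, a i j x * (g i x * g j x)) -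
      (2 * (f₀ x * ∑ i, ∑ j, a i j x * q i j) - ∑ i, ∑ j, a i j x * (g₀ i x * g₀ j x)))
      =o[L] fun x => n x ^ 2 := by
  have hT : (fun x => ∑ i, ∑ j, a i j x * h i j x - ∑ i, ∑ j, a i j x * q i j)
      =o[L] fun _ => (1 : ℝ) := by
    have : (fun x => ∑ i, ∑ j, a i j x * (h i j x - q i j)) =o[L] fun _ => (1 : ℝ) :=
      .fun_sum fun i _ => .fun_sum fun j _ => by
        simpa only [mul_one] using (ha i j).mul_isLittleO (hh i j)
    simpa [mul_sub, Finset.sum_sub_distrib] using this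
  have hT₀ : (fun x => ∑ i, ∑ j, a i j x * q i j) =O[L] fun _ => (1 : ℝ) :=
    .fun_sum fun i _ => .fun_sum fun j _ => by
      simpa only [mul_one] using (ha i j).mul (isBigO_const_const (q i j) one_ne_zero L)
  have h1 := (isLittleO_mul_sub_mul hf hf₀ hT hT₀).const_mul_left 2
  have h2 : (fun x => ∑ i, ∑ j, a i j x * (g i x * g j x - g₀ i x * g₀ j x))
      =o[L] fun x => n x ^ 2 :=
    .fun_sum fun i _ => .fun_sum fun j _ => by
      simpa only [one_mul, ← sq] using (ha i j).mul_isLittleO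
        (isLittleO_mul_sub_mul (hg i) (hg₀ i) (hg j) (hg₀ j))
  simp only [mul_one] at h1
  refine (h1.sub h2).congr_left fun x => ?_
  simp only [mul_sub, Finset.sum_sub_distrib]
  ring

/-- For `2 × 2` matrices, `tr(AQ) Q - Q A Q = det Q · adj A`, tested against a vector. -/
theorem trace_mul_quadForm_sub_eq (a q : Fin 2 → Fin 2 → ℝ) (x : Fin 2 → ℝ)
    (ha : a 0 1 = a 1 0) (hq : q 0 1 = q 1 0) :
    (∑ i, ∑ j, q i j * x i * x j) * (∑ i, ∑ j, a i j * q i j) -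
      ∑ i, ∑ j, a i j * ((∑ k, q i k * x k) * ∑ k, q j k * x k) =
    (q 0 0 * q 1 1 - q 0 1 * q 1 0) *
      ∑ i, ∑ j, ![x 1, -x 0] i * a i j * ![x 1, -x 0] j := by
  simp only [Fin.sum_univ_two, Matrix.cons_val_zero, Matrix.cons_val_one, ha, hq]
  ring

/-- A positive-definite binary quadratic form is bounded below by `det / tr`. -/
theorem det_mul_le_trace_mul_quadForm (q : Fin 2 → Fin 2 → ℝ) (x : Fin 2 → ℝ)
    (hq : q 0 1 = q 1 0) :
    (q 0 0 * q 1 1 - q 0 1 * q 1 0) * ∑ i, x i ^ 2 ≤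
      (q 0 0 + q 1 1) * ∑ i, ∑ j, q i j * x i * x j := by
  simp only [Fin.sum_univ_two, hq]
  nlinarith [sq_nonneg (q 0 0 * x 0 + q 1 0 * x 1), sq_nonneg (q 1 0 * x 0 + q 1 1 * x 1)]

/-- The drift expression equals the polynomial one up to a positive factor. -/
theorem div_sqrt_sub_div_rpow_pos {h A G : ℝ} (hh : 0 < h) (hp : 0 < 4 * h * A - G) :
    0 < A / (2 * √h) - G / (8 * h ^ ((3 : ℝ) / 2)) := by
  have hs : 0 < √h := Real.sqrt_pos.2 hh
  have hr : h ^ ((3 : ℝ) / 2) = h * √h := by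
    rw [Real.sqrt_eq_rpow, ← Real.rpow_one_add' hh.le (by norm_num)]
    norm_num
  rw [hr, show A / (2 * √h) - G / (8 * (h * √h)) = (4 * h * A - G) / (8 * (h * √h)) by
    field_simp; ring]
  positivity

theorem gradient_apply_eq_fderiv_single {ι : Type*} [Fintype ι] [DecidableEq ι]
    (f : EuclideanSpace ℝ ι → ℝ) (x : EuclideanSpace ℝ ι) (i : ι) :
    gradient f x i = fderiv ℝ f x (EuclideanSpace.single i 1) := by
  rw [← toDual_gradient, InnerProductSpace.toDual_apply_apply, EuclideanSpace.inner_single_right]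
  simp

theorem pd_pd_eq_fderiv_fderiv {f : EuclideanSpace ℝ (Fin 2) → ℝ} (hf : ContDiff ℝ 2 f)
    (i j : Fin 2) (x : EuclideanSpace ℝ (Fin 2)) :
    pd i (pd j f) x =
      fderiv ℝ (fderiv ℝ f) x (EuclideanSpace.single i 1) (EuclideanSpace.single j 1) := by
  have hd : DifferentiableAt ℝ (fderiv ℝ f) x :=
    (hf.fderiv_right (m := 1) (by norm_num)).differentiable (by norm_num) x
  unfold pd
  rw [fderiv_clm_apply hd (by fun_prop)]
  simp

/-- Lemma "positivedrift". Let `H : ℝ² → ℝ` be `C⁴` with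
`H(0) = 0`, `∇H(0) = 0`, positive-definite Hessian at the origin, and let
`σ : ℝ² → ℝ^{2×l}` be continuous with `a(x) = σ(x)σ(x)ᵀ` uniformly
positive-definite and bounded.  Writing `AH(x) = (1/2)∑_{i,j} a_{ij}(x) ∂²_{ij}H(x)`,
there exists `r > 0` such that for every `x ∈ B(0,r) \ {0}` one has `H(x) > 0`,
`AH(x)/(2√H(x)) - |σ(x)ᵀ∇H(x)|²/(8 H(x)^{3/2}) > 0` and, equivalently,
`4 H(x)·AH(x) - |σ(x)ᵀ∇H(x)|² > 0`. -/
theorem positive_drift_near_minimum {l : ℕ}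
    (H : EuclideanSpace ℝ (Fin 2) → ℝ) (hH : ContDiff ℝ 4 H)
    (hH0 : H 0 = 0) (hgrad0 : gradient H 0 = 0)
    (hHess : (Matrix.of fun i j : Fin 2 => pd i (pd j H) 0).PosDef)
    (σ : EuclideanSpace ℝ (Fin 2) → Matrix (Fin 2) (Fin l) ℝ) (hσ : Continuous σ)
    (m M : ℝ) (hm : 0 < m) (hmM : m ≤ M)
    (hlow : ∀ (x : EuclideanSpace ℝ (Fin 2)) (ξ : Fin 2 → ℝ),
      m * (∑ i, ξ i ^ 2) ≤ ∑ i, ∑ j, ξ i * (σ x * (σ x)ᵀ) i j * ξ j)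
    (hupp : ∀ (x : EuclideanSpace ℝ (Fin 2)) (ξ : Fin 2 → ℝ),
      (∑ i, ∑ j, ξ i * (σ x * (σ x)ᵀ) i j * ξ j) ≤ M * (∑ i, ξ i ^ 2)) :
    ∃ r > 0, ∀ x : EuclideanSpace ℝ (Fin 2), ‖x‖ < r → x ≠ 0 →
      0 < H x ∧
      0 < ((∑ i, ∑ j, (σ x * (σ x)ᵀ) i j * pd i (pd j H) x) / 2) /
            (2 * Real.sqrt (H x)) -
          (∑ j, (∑ i, σ x i j * gradient H x i) ^ 2) /
            (8 * H x ^ ((3 : ℝ) / 2)) ∧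
      0 < 4 * H x * ((∑ i, ∑ j, (σ x * (σ x)ᵀ) i j * pd i (pd j H) x) / 2) -
          ∑ j, (∑ i, σ x i j * gradient H x i) ^ 2 := by
  have hH2 : ContDiff ℝ 2 H := hH.of_le (by norm_num)
  set D := fderiv ℝ (fderiv ℝ H) 0
  set q : Fin 2 → Fin 2 → ℝ := fun i j => pd i (pd j H) 0 with hq
  have hqD : ∀ i j, q i j = D (EuclideanSpace.single i 1) (EuclideanSpace.single j 1) :=
    fun i j => pd_pd_eq_fderiv_fderiv hH2 i j 0
  have hqs : ∀ i j, q i j = q j i := fun i j => by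
    rw [hqD, hqD]
    exact (hH2.contDiffAt.isSymmSndFDerivAt (x := 0) (by simp)).eq _ _
  have hx : ∀ x : EuclideanSpace ℝ (Fin 2), x = ∑ i, x i • EuclideanSpace.single i (1 : ℝ) := by
    intro x
    ext j
    fin_cases j <;> simp [Fin.sum_univ_two]
  have hDj : ∀ x j, D x (EuclideanSpace.single j 1) = ∑ k, q j k * x k := by
    intro x j
    conv_lhs => rw [hx x]
    simp only [map_sum, map_smul, _root_.sum_apply, _root_.smul_apply,
      smul_eq_mul, ← hqD]
    exact Finset.sum_congr rfl fun k _ => by rw [hqs j k, mul_comm]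
  have hDx : ∀ x, D x x = ∑ i, ∑ j, q i j * x i * x j := by
    intro x
    conv_lhs => rw [hx x]
    rw [map_sum (D _)]
    simp only [map_smul, ← hx, hDj, smul_eq_mul, Finset.mul_sum]
    exact Finset.sum_congr rfl fun i _ => Finset.sum_congr rfl fun j _ => by ring
  have hf' : fderiv ℝ H 0 = 0 := by rw [← toDual_gradient, hgrad0, map_zero]
  have hcont : Continuous (fderiv ℝ (fderiv ℝ H)) :=
    (hH2.fderiv_right (m := 1) (by norm_num)).continuous_fderiv (by norm_num)
  have hd : HasFDerivAt (fderiv ℝ H) D 0 :=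
    ((hH2.fderiv_right (m := 1) (by norm_num)).differentiable (by norm_num) 0).hasFDerivAt
  have hT := isLittleO_sub_half_fderiv_fderiv hH2 hH0 hf'
  have hasymp := isLittleO_drift_sub (L := nhds (0 : EuclideanSpace ℝ (Fin 2)))
    (n := fun x => ‖x‖) (f := H) (f₀ := fun x => (1 / 2) * D x x)
    (g := fun i x => gradient H x i) (g₀ := fun i x => ∑ k, q i k * x k)
    (a := fun i j x => (σ x * (σ x)ᵀ) i j) (h := fun i j x => pd i (pd j H) x) (q := q)
    (fun i j => by
      have : Continuous fun x => (σ x * (σ x)ᵀ) i j :=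
        (hσ.matrix_mul hσ.matrix_transpose).matrix_elem i j
      exact this.continuousAt.isBigO_one ℝ)
    (fun i j => by
      rw [Asymptotics.isLittleO_one_iff]
      have : Continuous fun x => pd i (pd j H) x := by
        simp only [pd_pd_eq_fderiv_fderiv hH2]
        fun_prop
      simpa [hq] using (this.tendsto 0).sub_const (q i j))
    (fun i => by
      have h1 : (fun x => fderiv ℝ H x - D x) =o[nhds 0] fun x => ‖x‖ := by
        simpa [hf'] using hd.isLittleO.norm_right
      refine Asymptotics.IsBigO.trans_isLittleO (.of_bound ‖EuclideanSpace.single i (1 : ℝ)‖ ?_) h1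
      refine .of_forall fun x => ?_
      rw [← hDj, gradient_apply_eq_fderiv_single, ← _root_.sub_apply, mul_comm]
      exact ContinuousLinearMap.le_opNorm _ _)
    (fun i => by
      simp only [← hDj]
      exact ((D.flip (EuclideanSpace.single i 1)).isBigO_id _).norm_right)
    hT
    (.of_bound (1 / 2 * ‖D‖) <| .of_forall fun x => by
      have := D.le_opNorm₂ x x
      rw [norm_mul, norm_pow, norm_norm, Real.norm_of_nonneg (by norm_num : (0 : ℝ) ≤ 1 / 2)]
      nlinarith)
  have hdet : 0 < q 0 0 * q 1 1 - q 0 1 * q 1 0 := by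
    simpa [Matrix.det_fin_two] using hHess.det_pos
  have htr : 0 < q 0 0 + q 1 1 :=
    add_pos (by simpa using hHess.diag_pos (i := 0)) (by simpa using hHess.diag_pos (i := 1))
  have hnorm : ∀ x : EuclideanSpace ℝ (Fin 2), ‖x‖ ^ 2 = ∑ i, x i ^ 2 := fun x =>
    EuclideanSpace.real_norm_sq_eq x
  set d := q 0 0 * q 1 1 - q 0 1 * q 1 0
  set c := d / (q 0 0 + q 1 1) with hc
  have hcpos : 0 < c := div_pos hdet htr
  have hmd : 0 < d * m := mul_pos hdet hm
  obtain ⟨r, hr, hball⟩ := Metric.eventually_nhds_iff.1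
    ((hT.bound (half_pos (half_pos hcpos))).and (hasymp.bound (half_pos hmd)))
  refine ⟨r, hr, fun x hxr hx0 => ?_⟩
  obtain ⟨hb1, hb2⟩ := hball (y := x) (by simpa using hxr)
  have hn : 0 < ‖x‖ ^ 2 := by positivity
  rw [norm_pow, norm_norm, Real.norm_eq_abs, abs_le] at hb1 hb2
  have hlowD : c * ‖x‖ ^ 2 ≤ D x x := by
    rw [hc, div_mul_eq_mul_div, div_le_iff₀ htr, hnorm, hDx, mul_comm (∑ i, ∑ j, _)]
    exact det_mul_le_trace_mul_quadForm q x (hqs 0 1)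
  have hHpos : 0 < H x := by nlinarith [mul_pos hcpos hn, hb1.1]
  have hlead : d * m * ‖x‖ ^ 2 ≤ 2 * ((1 / 2) * D x x * ∑ i, ∑ j, (σ x * (σ x)ᵀ) i j * q i j) -
      ∑ i, ∑ j, (σ x * (σ x)ᵀ) i j * ((∑ k, q i k * x k) * ∑ k, q j k * x k) := by
    have hsym : (σ x * (σ x)ᵀ) 0 1 = (σ x * (σ x)ᵀ) 1 0 := by
      simp [Matrix.mul_apply, mul_comm]
    have h1 := trace_mul_quadForm_sub_eq (fun i j => (σ x * (σ x)ᵀ) i j) q x hsym (hqs 0 1)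
    rw [← hDx] at h1
    have h2 := mul_le_mul_of_nonneg_left (hlow x ![x 1, -x 0]) hdet.le
    rw [hnorm, Fin.sum_univ_two]
    simp only [Fin.sum_univ_two, Matrix.cons_val_zero, Matrix.cons_val_one] at h1 h2 ⊢
    linarith
  have hG : ∑ j, (∑ i, σ x i j * gradient H x i) ^ 2 =
      ∑ i, ∑ j, (σ x * (σ x)ᵀ) i j * (gradient H x i * gradient H x j) := by
    simp only [Matrix.mul_apply, Matrix.transpose_apply, Fin.sum_univ_two, Finset.sum_mul,
      ← Finset.sum_add_distrib]
    exact Finset.sum_congr rfl fun j _ => by ring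
  have hmain : 0 < 4 * H x * ((∑ i, ∑ j, (σ x * (σ x)ᵀ) i j * pd i (pd j H) x) / 2) -
      ∑ j, (∑ i, σ x i j * gradient H x i) ^ 2 := by
    rw [hG]
    nlinarith [hb2.1, mul_pos hmd hn]
  exact ⟨hHpos, div_sqrt_sub_div_rpow_pos hHpos hmain, hmain⟩

end
end

section
/- Let b(x) be the symmetric 2×2 matrix-valued function with entries b₁₁(x) = 2H(x)·∂²H/∂x̂²(x) − (∂H/∂x̂(x))², b₂₂(x) = 2H(x)·∂²H/∂ŷ²(x) − (∂H/∂ŷ(x))², and b₁₂(x) = b₂₁(x) = 2H(x)·∂²H/∂x̂∂ŷ(x) − ∂H/∂x̂(x)·∂H/∂ŷ(x). Then det(b(x)) = O(|x|⁵) as x → 0. -/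
open Asymptotics Filter

noncomputable section

/-- Partial derivative in the first coordinate (`∂/∂x̂`). -/
def pdx (f : ℝ × ℝ → ℝ) : ℝ × ℝ → ℝ := fun p => fderiv ℝ f p (1, 0)

/-- Partial derivative in the second coordinate (`∂/∂ŷ`). -/
def pdy (f : ℝ × ℝ → ℝ) : ℝ × ℝ → ℝ := fun p => fderiv ℝ f p (0, 1)

/-- A differentiable function vanishing at the origin whose derivative is `O(‖p‖ ^ k)` is itself
`O(‖p‖ ^ (k + 1))`. -/
theorem isBigO_norm_pow_succ_of_fderiv {E F : Type*} [NormedAddCommGroup E] [NormedSpace ℝ E]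
    [NormedAddCommGroup F] [NormedSpace ℝ F] {f : E → F} (hf : Differentiable ℝ f)
    (hf0 : f 0 = 0) {k : ℕ} (h : fderiv ℝ f =O[nhds 0] fun p => ‖p‖ ^ k) :
    f =O[nhds 0] fun p => ‖p‖ ^ (k + 1) := by
  obtain ⟨C, hC0, hC⟩ := h.exists_nonneg
  obtain ⟨ε, hε, hball⟩ := Metric.eventually_nhds_iff_ball.1 hC.bound
  refine IsBigO.of_bound C (Metric.eventually_nhds_iff_ball.2 ⟨ε, hε, fun p hp => ?_⟩)
  have hbound : ∀ q ∈ Metric.closedBall (0 : E) ‖p‖, ‖fderiv ℝ f q‖ ≤ C * ‖p‖ ^ k := by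
    intro q hq
    rw [mem_closedBall_zero_iff] at hq
    refine (hball q ?_).trans ?_
    · rw [mem_ball_zero_iff] at hp ⊢
      exact hq.trans_lt hp
    · rw [norm_pow, norm_norm]
      gcongr
  have hmv := (convex_closedBall (0 : E) ‖p‖).norm_image_sub_le_of_norm_fderiv_le
    (fun q _ => hf q) hbound (x := 0) (y := p) (by simp) (by simp)
  simpa [hf0, pow_succ, mul_assoc] using hmv

/-- A `C²` function differs from its linear Taylor polynomial at `0` by `O(‖p‖ ^ 2)`. -/
theorem ContDiff.isBigO_sub_fderiv_zero {E F : Type*} [NormedAddCommGroup E] [NormedSpace ℝ E]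
    [NormedAddCommGroup F] [NormedSpace ℝ F] {f : E → F} (hf : ContDiff ℝ 2 f) (hf0 : f 0 = 0) :
    (fun p => f p - fderiv ℝ f 0 p) =O[nhds 0] fun p => ‖p‖ ^ 2 := by
  have hd : Differentiable ℝ f := hf.differentiable (by norm_num)
  have hd' : Differentiable ℝ (fderiv ℝ f) :=
    (hf.fderiv_right (m := 1) (by norm_num)).differentiable (by norm_num)
  refine isBigO_norm_pow_succ_of_fderiv (k := 1)
    (hd.fun_sub (fderiv ℝ f 0).differentiable) (by simp [hf0]) ?_
  have hfd : fderiv ℝ (fun p => f p - fderiv ℝ f 0 p) = fun p => fderiv ℝ f p - fderiv ℝ f 0 := by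
    ext1 p
    rw [fderiv_fun_sub (hd p) (fderiv ℝ f 0).differentiableAt, ContinuousLinearMap.fderiv]
  rw [hfd]
  simpa using (hd' 0).isBigO_sub.norm_right

/-- Quadratic Taylor expansion at a critical zero of a `C³` function, with cubic remainder. -/
theorem ContDiff.isBigO_two_mul_sub_fderiv_fderiv_zero {E : Type*} [NormedAddCommGroup E]
    [NormedSpace ℝ E] {f : E → ℝ} (hf : ContDiff ℝ 3 f) (hf0 : f 0 = 0)
    (hgrad : fderiv ℝ f 0 = 0) :
    (fun p => 2 * f p - fderiv ℝ (fderiv ℝ f) 0 p p) =O[nhds 0] fun p => ‖p‖ ^ 3 := by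
  have hd : Differentiable ℝ f := hf.differentiable (by norm_num)
  have hsymm : IsSymmSndFDerivAt ℝ f 0 :=
    hf.contDiffAt.isSymmSndFDerivAt (by simp; norm_num)
  set B := fderiv ℝ (fderiv ℝ f) 0 with hB
  have hfd : ∀ p, HasFDerivAt (fun p => 2 * f p - B p p)
      ((2 : ℝ) • (fderiv ℝ f p - B p)) p := by
    intro p
    refine (((hd p).hasFDerivAt.const_mul 2).sub
      (B.hasFDerivAt.clm_apply (hasFDerivAt_id p))).congr_fderiv ?_
    ext v
    have := hsymm v p
    simp only [← hB] at this
    simp [this]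
    ring
  refine isBigO_norm_pow_succ_of_fderiv (k := 2) (fun p => (hfd p).differentiableAt)
    (by simp [hf0]) ?_
  rw [show fderiv ℝ (fun p => 2 * f p - B p p) = fun p => (2 : ℝ) • (fderiv ℝ f p - B p) from
    funext fun p => (hfd p).fderiv]
  exact ((hf.fderiv_right (m := 2) (by norm_num)).isBigO_sub_fderiv_zero hgrad).const_smul_left (2 : ℝ)

/-- Products of `O(‖p‖ ^ m)` and `O(‖p‖ ^ n)` functions are `O(‖p‖ ^ k)` for `k = m + n`. -/
theorem isBigO_norm_pow_mul {E : Type*} [NormedAddCommGroup E] {l : Filter E} {f g : E → ℝ}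
    {m n k : ℕ} (hf : f =O[l] fun p => ‖p‖ ^ m) (hg : g =O[l] fun p => ‖p‖ ^ n)
    (hk : m + n = k) : (fun p => f p * g p) =O[l] fun p => ‖p‖ ^ k := by
  subst hk
  simpa only [pow_add] using hf.mul hg

/-- Let `H : ℝ² → ℝ` be `C⁴` with `H(0,0) = 0`, `∇H(0,0) = 0`,
and let `b(x)` be the symmetric 2×2 matrix with entries
`b₁₁ = 2H·H_{x̂x̂} - H_x̂²`, `b₂₂ = 2H·H_{ŷŷ} - H_ŷ²`,
`b₁₂ = b₂₁ = 2H·H_{x̂ŷ} - H_x̂H_ŷ`.  Then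
`det b(x) = b₁₁(x)b₂₂(x) - b₁₂(x)² = O(|x|⁵)` as `x → 0`. -/
theorem det_b_is_bigO_five
    (H : ℝ × ℝ → ℝ) (hH : ContDiff ℝ 4 H)
    (hH0 : H 0 = 0) (hgrad : fderiv ℝ H 0 = 0) :
    (fun p : ℝ × ℝ =>
        (2 * H p * pdx (pdx H) p - (pdx H p) ^ 2) *
            (2 * H p * pdy (pdy H) p - (pdy H p) ^ 2) -
          (2 * H p * pdx (pdy H) p - pdx H p * pdy H p) ^ 2)
      =O[nhds 0] (fun p : ℝ × ℝ => ‖p‖ ^ 5) := by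
  have hD : ContDiff ℝ 3 (fderiv ℝ H) := hH.fderiv_right (by norm_num)
  have hDd : Differentiable ℝ (fderiv ℝ H) := hD.differentiable (by norm_num)
  have hD2 : ContDiff ℝ 2 (fderiv ℝ (fderiv ℝ H)) := hD.fderiv_right (by norm_num)
  have happ : ∀ v w p, fderiv ℝ (fun q => fderiv ℝ H q v) p w = fderiv ℝ (fderiv ℝ H) p w v := by
    intro v w p
    have := ((hDd p).hasFDerivAt.clm_apply (hasFDerivAt_const v p)).fderiv
    rw [this]
    simp
  have hsymm : IsSymmSndFDerivAt ℝ H 0 := hH.contDiffAt.isSymmSndFDerivAt (by simp; norm_num)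
  have hT0 := (hH.of_le (by norm_num)).isBigO_two_mul_sub_fderiv_fderiv_zero hH0 hgrad
  have hT1 := (hD.of_le (by norm_num)).isBigO_sub_fderiv_zero hgrad
  have hT2 : (fun p => fderiv ℝ (fderiv ℝ H) p - fderiv ℝ (fderiv ℝ H) 0) =O[nhds 0]
      fun p => ‖p‖ ^ 1 := by
    simpa using (hD2.differentiable (by norm_num) 0).isBigO_sub.norm_right
  have hT1v : ∀ v, (fun p => fderiv ℝ H p v - fderiv ℝ (fderiv ℝ H) 0 p v) =O[nhds 0]
      fun p => ‖p‖ ^ 2 := fun v =>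
    ((ContinuousLinearMap.apply ℝ ℝ v).isBigO_comp _ _).trans hT1
  have hT2v : ∀ w v, (fun p => fderiv ℝ (fderiv ℝ H) p w v - fderiv ℝ (fderiv ℝ H) 0 w v)
      =O[nhds 0] fun p => ‖p‖ ^ 1 := fun w v =>
    ((ContinuousLinearMap.apply ℝ ℝ v).isBigO_comp _ _).trans
      (((ContinuousLinearMap.apply ℝ _ w).isBigO_comp _ _).trans hT2)
  have hs := hsymm (0, 1) (1, 0)
  obtain ⟨a, ha⟩ : ∃ a, a = fderiv ℝ (fderiv ℝ H) 0 (1, 0) (1, 0) := ⟨_, rfl⟩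
  obtain ⟨b, hb⟩ : ∃ b, b = fderiv ℝ (fderiv ℝ H) 0 (1, 0) (0, 1) := ⟨_, rfl⟩
  obtain ⟨c, hc⟩ : ∃ c, c = fderiv ℝ (fderiv ℝ H) 0 (0, 1) (0, 1) := ⟨_, rfl⟩
  have hB : ∀ p v : ℝ × ℝ, fderiv ℝ (fderiv ℝ H) 0 p v
      = a * (p.1 * v.1) + b * (p.1 * v.2 + p.2 * v.1) + c * (p.2 * v.2) := by
    intro p v
    have hdec : ∀ q : ℝ × ℝ, q = q.1 • ((1, 0) : ℝ × ℝ) + q.2 • ((0, 1) : ℝ × ℝ) := by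
      intro q; ext <;> simp
    conv_lhs => rw [hdec p, hdec v]
    simp only [map_add, map_smul, add_apply, smul_apply,
      smul_eq_mul, hs, ← ha, ← hb, ← hc]
    ring
  have hxx : pdx (pdx H) = fun p => fderiv ℝ (fderiv ℝ H) p (1, 0) (1, 0) :=
    funext fun p => happ _ _ p
  have hxy : pdx (pdy H) = fun p => fderiv ℝ (fderiv ℝ H) p (1, 0) (0, 1) :=
    funext fun p => happ _ _ p
  have hyy : pdy (pdy H) = fun p => fderiv ℝ (fderiv ℝ H) p (0, 1) (0, 1) :=
    funext fun p => happ _ _ p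
  have hA : (fun p => pdx (pdx H) p - a) =O[nhds 0] fun p => ‖p‖ ^ 1 := by
    simpa only [hxx, ha] using hT2v (1, 0) (1, 0)
  have hBb : (fun p => pdx (pdy H) p - b) =O[nhds 0] fun p => ‖p‖ ^ 1 := by
    simpa only [hxy, hb] using hT2v (1, 0) (0, 1)
  have hC : (fun p => pdy (pdy H) p - c) =O[nhds 0] fun p => ‖p‖ ^ 1 := by
    simpa only [hyy, hc] using hT2v (0, 1) (0, 1)
  have hX : (fun p : ℝ × ℝ => pdx H p - (a * p.1 + b * p.2)) =O[nhds 0] fun p => ‖p‖ ^ 2 := by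
    simpa [hB, pdx] using hT1v (1, 0)
  have hY : (fun p : ℝ × ℝ => pdy H p - (b * p.1 + c * p.2)) =O[nhds 0] fun p => ‖p‖ ^ 2 := by
    simpa [hB, pdy] using hT1v (0, 1)
  have hQ : (fun p : ℝ × ℝ =>
      2 * H p - (a * (p.1 * p.1) + b * (p.1 * p.2 + p.2 * p.1) + c * (p.2 * p.2)))
      =O[nhds 0] fun p => ‖p‖ ^ 3 := by
    simpa only [hB] using hT0
  have hpow : ∀ {m n : ℕ}, n ≤ m →
      (fun p : ℝ × ℝ => ‖p‖ ^ m) =O[nhds 0] fun p => ‖p‖ ^ n := by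
    intro m n hmn
    refine IsBigO.of_bound 1 ?_
    filter_upwards [Metric.closedBall_mem_nhds (0 : ℝ × ℝ) one_pos] with p hp
    rw [mem_closedBall_zero_iff] at hp
    simpa using pow_le_pow_of_le_one (norm_nonneg p) hp hmn
  have hconst : ∀ d : ℝ, (fun _ : ℝ × ℝ => d) =O[nhds 0] fun p => ‖p‖ ^ 0 := fun d => by
    simpa only [pow_zero] using isBigO_const_const d (one_ne_zero (α := ℝ)) (nhds (0 : ℝ × ℝ))
  have h1 : (fun p : ℝ × ℝ => p.1) =O[nhds 0] fun p => ‖p‖ ^ 1 := by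
    simpa using (isBigO_fst_prod' (f' := fun p : ℝ × ℝ => p) (l := nhds 0)).norm_right
  have h2 : (fun p : ℝ × ℝ => p.2) =O[nhds 0] fun p => ‖p‖ ^ 1 := by
    simpa using (isBigO_snd_prod' (f' := fun p : ℝ × ℝ => p) (l := nhds 0)).norm_right
  have hL1 : (fun p : ℝ × ℝ => a * p.1 + b * p.2) =O[nhds 0] fun p => ‖p‖ ^ 1 :=
    (h1.const_mul_left a).add (h2.const_mul_left b)
  have hL2 : (fun p : ℝ × ℝ => b * p.1 + c * p.2) =O[nhds 0] fun p => ‖p‖ ^ 1 :=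
    (h1.const_mul_left b).add (h2.const_mul_left c)
  have hX1 : pdx H =O[nhds 0] fun p => ‖p‖ ^ 1 :=
    ((hX.trans (hpow one_le_two)).add hL1).congr_left fun p => by ring
  have hY1 : pdy H =O[nhds 0] fun p => ‖p‖ ^ 1 :=
    ((hY.trans (hpow one_le_two)).add hL2).congr_left fun p => by ring
  have hA0 : pdx (pdx H) =O[nhds 0] fun p => ‖p‖ ^ 0 :=
    ((hA.trans (hpow zero_le_one)).add (hconst a)).congr_left fun p => by ring
  have hB0 : pdx (pdy H) =O[nhds 0] fun p => ‖p‖ ^ 0 :=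
    ((hBb.trans (hpow zero_le_one)).add (hconst b)).congr_left fun p => by ring
  have hC0 : pdy (pdy H) =O[nhds 0] fun p => ‖p‖ ^ 0 :=
    ((hC.trans (hpow zero_le_one)).add (hconst c)).congr_left fun p => by ring
  have hq : (fun p : ℝ × ℝ =>
      a * (p.1 * p.1) + b * (p.1 * p.2 + p.2 * p.1) + c * (p.2 * p.2))
      =O[nhds 0] fun p => ‖p‖ ^ 2 :=
    (((isBigO_norm_pow_mul h1 h1 rfl).const_mul_left a).add
      (((isBigO_norm_pow_mul h1 h2 rfl).add (isBigO_norm_pow_mul h2 h1 rfl)).const_mul_left b)).add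
      ((isBigO_norm_pow_mul h2 h2 rfl).const_mul_left c)
  have hH2 : (fun p => 2 * H p) =O[nhds 0] fun p => ‖p‖ ^ 2 :=
    ((hQ.trans (hpow (by norm_num))).add hq).congr_left fun p => by ring
  have hdet0 := (isBigO_norm_pow_mul hA0 hC0 rfl).sub (isBigO_norm_pow_mul hB0 hB0 rfl)
  have hdet1 := ((isBigO_norm_pow_mul hA hC0 rfl).add (hC.const_mul_left a)).sub
    (isBigO_norm_pow_mul hBb (hB0.add (hconst b)) rfl)
  have hYY := isBigO_norm_pow_mul hA (isBigO_norm_pow_mul hY1 hY1 rfl) rfl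
  have hXY := isBigO_norm_pow_mul hBb (isBigO_norm_pow_mul hX1 hY1 rfl) rfl
  have hXX := isBigO_norm_pow_mul hC (isBigO_norm_pow_mul hX1 hX1 rfl) rfl
  have hYY' := isBigO_norm_pow_mul hY (hY1.add hL2) rfl
  have hXX' := isBigO_norm_pow_mul hX (hX1.add hL1) rfl
  have hXY' := (isBigO_norm_pow_mul hX hY1 rfl).add (isBigO_norm_pow_mul hL1 hY rfl)
  have hbracket := ((isBigO_norm_pow_mul hQ hdet0 rfl).add (isBigO_norm_pow_mul hq hdet1 rfl)).sub
    (((hYY.add (hYY'.const_mul_left a)).sub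
      ((hXY.add (hXY'.const_mul_left b)).const_mul_left 2)).add
      (hXX.add (hXX'.const_mul_left c)))
  refine (isBigO_norm_pow_mul hH2 hbracket rfl).congr_left fun p => ?_
  ring

end
end

section
/- Let T > 0 and let φ : [0,T] → [0,∞) be absolutely continuous with φ(0) = 0. If ∫₀^T (φ'(t))²/φ(t) · 1_{φ(t)>0} dt < ∞, then for every t ∈ (0,T], (1/t)∫₀^t |φ'(s)| ds ≤ ∫₀^t (φ'(s))²/φ(s) · 1_{φ(s)>0} ds; in particular φ(t)/t → 0 as t → 0⁺, i.e. the right derivative of φ at 0 exists and equals 0. -/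
open MeasureTheory Set Filter

/-- A nonnegative function that is a primitive of `g` on `[0, T]` has `g = 0` almost everywhere
on its zero set. -/
theorem ae_eq_zero_of_nonneg_primitive_eq_zero {T : ℝ} (hT : 0 < T) {φ g : ℝ → ℝ}
    (hg : IntervalIntegrable g volume 0 T)
    (hrep : ∀ t ∈ Icc 0 T, φ t = ∫ s in (0:ℝ)..t, g s)
    (hφ : ∀ t ∈ Icc 0 T, 0 ≤ φ t) :
    ∀ᵐ s, s ∈ Ioo 0 T → φ s = 0 → g s = 0 := by
  filter_upwards [hg.ae_hasDerivAt_integral] with s hs hsT hzero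
  have hmem : s ∈ uIcc 0 T := by
    rw [uIcc_of_le hT.le]
    exact Ioo_subset_Icc_self hsT
  have hder := hs hmem 0 left_mem_uIcc
  have hmin : IsLocalMin (fun x => ∫ t in (0:ℝ)..x, g t) s := by
    filter_upwards [isOpen_Ioo.mem_nhds hsT] with x hx
    rw [← hrep x (Ioo_subset_Icc_self hx), ← hrep s (Ioo_subset_Icc_self hsT), hzero]
    exact hφ x (Ioo_subset_Icc_self hx)
  exact hmin.hasDerivAt_eq_zero hder

/-- If `g ^ 2 ≤ A * h` on `[0, t]`, where `A` is the integral of `|g|`, then the mean of `|g|`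
is at most the integral of `h`. -/
theorem mean_abs_le_integral_of_sq_le {t : ℝ} (ht : 0 < t) {g h : ℝ → ℝ}
    (hg : IntervalIntegrable g volume 0 t) (hh : IntervalIntegrable h volume 0 t)
    (hh0 : 0 ≤ ∫ s in (0:ℝ)..t, h s)
    (hle : ∀ᵐ s, s ∈ Ioo 0 t → g s ^ 2 ≤ (∫ r in (0:ℝ)..t, |g r|) * h s) :
    (1 / t) * ∫ s in (0:ℝ)..t, |g s| ≤ ∫ s in (0:ℝ)..t, h s := by
  set A := ∫ s in (0:ℝ)..t, |g s| with hA
  have hA0 : 0 ≤ A := intervalIntegral.integral_nonneg ht.le fun _ _ => abs_nonneg _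
  have hmono : ∫ s in (0:ℝ)..t, 2 * (A / t) * |g s| ≤
      ∫ s in (0:ℝ)..t, (A * h s + (A / t) ^ 2) := by
    refine intervalIntegral.integral_mono_ae_restrict ht.le (hg.abs.const_mul _)
      ((hh.const_mul _).add intervalIntegrable_const) ?_
    rw [EventuallyLE, ← restrict_Ioo_eq_restrict_Icc, ae_restrict_iff' measurableSet_Ioo]
    filter_upwards [hle] with s hs hst
    nlinarith [sq_nonneg (|g s| - A / t), sq_abs (g s), hs hst]
  rw [intervalIntegral.integral_const_mul,
    intervalIntegral.integral_add (hh.const_mul _) intervalIntegrable_const,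
    intervalIntegral.integral_const_mul, intervalIntegral.integral_const, ← hA] at hmono
  rcases hA0.eq_or_lt with h0 | hpos
  · rw [← h0, mul_zero]
    exact hh0
  · refine le_of_mul_le_mul_left ?_ hpos
    have e₁ : 2 * (A / t) * A = 2 * (A * (1 / t * A)) := by ring
    have e₂ : (t - 0) • (A / t) ^ 2 = A * (1 / t * A) := by
      rw [smul_eq_mul]
      field_simp
      ring
    linarith

/-- Lemma "zeroderivative", single-edge version. Let `φ` be
absolutely continuous on `[0,T]` (with a.e. derivative `g`), nonnegative, with
`φ(0) = 0`.  If `∫₀ᵀ (φ')²/φ · 1_{φ>0} dt < ∞`, then for every `t ∈ (0,T]`,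
`(1/t)∫₀ᵗ |φ'(s)| ds ≤ ∫₀ᵗ (φ'(s))²/φ(s) · 1_{φ(s)>0} ds`; in particular
`φ(t)/t → 0` as `t → 0⁺`. -/
theorem right_derivative_zero_at_exterior_vertex
    (T : ℝ) (hT : 0 < T) (φ g : ℝ → ℝ)
    (hg : IntegrableOn g (Icc 0 T))
    (hrep : ∀ t ∈ Icc 0 T, φ t = φ 0 + ∫ s in (0:ℝ)..t, g s)
    (hφ0 : φ 0 = 0)
    (hφnonneg : ∀ t ∈ Icc 0 T, 0 ≤ φ t)
    (hfin : ∫⁻ t in Icc 0 T,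
        ENNReal.ofReal (if 0 < φ t then g t ^ 2 / φ t else 0) < ⊤) :
    (∀ t : ℝ, 0 < t → t ≤ T →
      (1 / t) * ∫ s in (0:ℝ)..t, |g s| ≤
        ∫ s in (0:ℝ)..t, (if 0 < φ s then g s ^ 2 / φ s else 0)) ∧
    Tendsto (fun t => φ t / t) (nhdsWithin 0 (Ioi 0)) (nhds 0) := by
  set h : ℝ → ℝ := fun s => if 0 < φ s then g s ^ 2 / φ s else 0 with hdef
  have hrep' : ∀ t ∈ Icc 0 T, φ t = ∫ s in (0:ℝ)..t, g s := fun t ht => by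
    rw [hrep t ht, hφ0, zero_add]
  have hgT : IntervalIntegrable g volume 0 T :=
    (intervalIntegrable_iff_integrableOn_Icc_of_le hT.le).2 hg
  have hh0 : ∀ s, 0 ≤ h s := fun s => by
    simp only [hdef]
    split_ifs with hs
    · positivity
    · exact le_rfl
  have hφcont : ContinuousOn φ (Icc 0 T) := by
    refine ContinuousOn.congr ?_ hrep'
    rw [← uIcc_of_le hT.le] at hg ⊢
    exact intervalIntegral.continuousOn_primitive_interval hg
  have hhmeas : AEStronglyMeasurable h (volume.restrict (Icc 0 T)) := by
    have hφmeas := hφcont.aemeasurable measurableSet_Icc (μ := volume)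
    refine ((hg.aemeasurable.pow_const 2).div hφmeas).aestronglyMeasurable.congr ?_
    filter_upwards [ae_restrict_mem measurableSet_Icc] with s hs
    rcases (hφnonneg s hs).eq_or_lt with h0 | hpos
    · simp [hdef, ← h0]
    · simp [hdef, hpos]
  have hhT : IntegrableOn h (Icc 0 T) :=
    ⟨hhmeas, (hasFiniteIntegral_iff_ofReal (Eventually.of_forall hh0)).2 hfin⟩
  have hsub : ∀ {t : ℝ}, t ≤ T → Icc 0 t ⊆ Icc 0 T := fun ht => Icc_subset_Icc_right ht
  have hφle : ∀ t, 0 ≤ t → t ≤ T → ∀ s ∈ Icc 0 t, φ s ≤ ∫ r in (0:ℝ)..t, |g r| := by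
    intro t ht htT s hs
    have hgt : IntervalIntegrable g volume 0 t :=
      (intervalIntegrable_iff_integrableOn_Icc_of_le ht).2 (hg.mono_set (hsub htT))
    calc φ s = ∫ r in (0:ℝ)..s, g r := hrep' s (hsub htT hs)
      _ ≤ |∫ r in (0:ℝ)..s, g r| := le_abs_self _
      _ ≤ ∫ r in (0:ℝ)..s, |g r| := intervalIntegral.abs_integral_le_integral_abs hs.1
      _ ≤ ∫ r in (0:ℝ)..t, |g r| :=
        intervalIntegral.integral_mono_interval le_rfl hs.1 hs.2
          (Eventually.of_forall fun _ => abs_nonneg _) hgt.abs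
  have hmean : ∀ t : ℝ, 0 < t → t ≤ T →
      (1 / t) * ∫ s in (0:ℝ)..t, |g s| ≤ ∫ s in (0:ℝ)..t, h s := by
    intro t ht htT
    refine mean_abs_le_integral_of_sq_le ht
      ((intervalIntegrable_iff_integrableOn_Icc_of_le ht.le).2 (hg.mono_set (hsub htT)))
      ((intervalIntegrable_iff_integrableOn_Icc_of_le ht.le).2 (hhT.mono_set (hsub htT)))
      (intervalIntegral.integral_nonneg ht.le fun s _ => hh0 s) ?_
    filter_upwards [ae_eq_zero_of_nonneg_primitive_eq_zero hT hgT hrep' hφnonneg] with s hs hst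
    have hsT : s ∈ Icc 0 T := hsub htT (Ioo_subset_Icc_self hst)
    rcases (hφnonneg s hsT).eq_or_lt with h0 | hpos
    · rw [hs ⟨hst.1, hst.2.trans_le htT⟩ h0.symm]
      simp [hdef, ← h0]
    · calc g s ^ 2 = φ s * h s := by
            simp only [hdef, if_pos hpos]
            field_simp
        _ ≤ _ := mul_le_mul_of_nonneg_right
          (hφle t ht.le htT s (Ioo_subset_Icc_self hst)) (hh0 s)
  refine ⟨hmean, ?_⟩
  have hlim : Tendsto (fun t => ∫ s in (0:ℝ)..t, h s) (nhdsWithin 0 (Ioi 0)) (nhds 0) := by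
    have hcont : ContinuousOn (fun t => ∫ s in (0:ℝ)..t, h s) (Icc 0 T) := by
      rw [← uIcc_of_le hT.le] at hhT ⊢
      exact intervalIntegral.continuousOn_primitive_interval hhT
    have hz := (hcont 0 ⟨le_rfl, hT.le⟩).tendsto
    rw [intervalIntegral.integral_same] at hz
    exact hz.mono_left (nhdsWithin_le_of_mem (Icc_mem_nhdsGT hT))
  refine tendsto_of_tendsto_of_tendsto_of_le_of_le' tendsto_const_nhds hlim ?_ ?_
  · filter_upwards [Ioc_mem_nhdsGT hT] with t ht
    exact div_nonneg (hφnonneg t (Ioc_subset_Icc_self ht)) ht.1.le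
  · filter_upwards [Ioc_mem_nhdsGT hT] with t ht
    refine le_trans ?_ (hmean t ht.1 ht.2)
    rw [div_eq_inv_mul, one_div]
    exact mul_le_mul_of_nonneg_left (hφle t ht.1.le ht.2 t ⟨ht.1.le, le_rfl⟩)
      (inv_nonneg.2 ht.1.le)
end

section
/- If B² : ℝ → [0,∞) is locally Lipschitz continuous, then the functional S : C([0,T], ℝ) → [0,∞] is lower semicontinuous with respect to uniform convergence: whenever φ^{(l)} → φ uniformly on [0,T], one has S(φ) ≤ liminf_{l→∞} S(φ^{(l)}). -/
open MeasureTheory Set Filter Classical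

/-- The action functional `S` on `C([0,T], ℝ)` associated with a diffusion
coefficient `B² : ℝ → [0,∞)`:
`S(φ) = (1/2)∫₀ᵀ (φ'(t))²/B²(φ(t)) dt` if `φ` is absolutely continuous on
`[0,T]` (in which case `h.choose` is an a.e. derivative of `φ`), and
`S(φ) = +∞` otherwise.  The division is performed in `[0,∞]`, which realizes
the conventions `0/0 = 0` and `x/0 = ∞` for `x > 0`; in particular the value is
`+∞` whenever the integral is infinite. -/

noncomputable def energy (B2 : ℝ → ℝ) (T : ℝ) (φ : ℝ → ℝ) : ENNReal :=
  if h : ∃ g : ℝ → ℝ, IntegrableOn g (Icc 0 T) ∧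
      ∀ t ∈ Icc 0 T, φ t = φ 0 + ∫ s in (0:ℝ)..t, g s then
    (1 / 2) * ∫⁻ t in Icc 0 T,
      ENNReal.ofReal (h.choose t ^ 2) / ENNReal.ofReal (B2 (φ t))
  else ⊤

open scoped Topology

/-- A norm-bounded family in a real Hilbert space converges weakly along some finer ultrafilter,
with the same bound for the limit. -/
theorem exists_ultrafilter_tendsto_inner {ι H : Type*} [NormedAddCommGroup H]
    [InnerProductSpace ℝ H] [CompleteSpace H] (F : Filter ι) [F.NeBot] (u : ι → H) {R : ℝ}
    (hu : ∀ i, ‖u i‖ ≤ R) :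
    ∃ U : Ultrafilter ι, (U : Filter ι) ≤ F ∧ ∃ x : H, ‖x‖ ≤ R ∧
      ∀ v, Tendsto (fun i => inner ℝ (u i) v) U (𝓝 (inner ℝ x v)) := by
  let U := Ultrafilter.of F
  let D : ι → WeakDual ℝ H := fun i =>
    StrongDual.toWeakDual (InnerProductSpace.toDual ℝ H (u i))
  obtain ⟨a, ha, hle⟩ := (WeakDual.isCompact_closedBall (0 : StrongDual ℝ H) R).ultrafilter_le_nhds
    (U.map D) (by
      rw [le_principal_iff]
      refine Filter.Eventually.of_forall (f := (U : Filter ι)) fun i => ?_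
      simpa [D] using hu i)
  refine ⟨U, Ultrafilter.of_le F, (InnerProductSpace.toDual ℝ H).symm (WeakDual.toStrongDual a),
    ?_, fun v => ?_⟩
  · rw [LinearIsometryEquiv.norm_map]
    simpa using ha
  · have hD : Tendsto D U (𝓝 a) := hle
    have := (WeakDual.eval_continuous v).continuousAt.tendsto.comp hD
    rw [InnerProductSpace.toDual_symm_apply]
    exact this

theorem lintegral_ofReal_sq_eq {α : Type*} [MeasurableSpace α] {μ : Measure α}
    (f : Lp ℝ 2 μ) : ∫⁻ t, ENNReal.ofReal (f t ^ 2) ∂μ = ENNReal.ofReal (‖f‖ ^ 2) := by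
  have h := L2.integrable_inner (𝕜 := ℝ) f f
  rw [← real_inner_self_eq_norm_sq, L2.inner_def, ofReal_integral_eq_lintegral_ofReal h
    (Eventually.of_forall fun t => real_inner_self_nonneg)]
  simp [pow_two]

/-- Integrable densities with the same primitive agree almost everywhere. -/
theorem ae_eq_of_integral_eq {T : ℝ} (hT : 0 ≤ T) {f g : ℝ → ℝ}
    (hf : IntegrableOn f (Icc 0 T)) (hg : IntegrableOn g (Icc 0 T))
    (h : ∀ t ∈ Icc 0 T, ∫ s in (0 : ℝ)..t, f s = ∫ s in (0 : ℝ)..t, g s) :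
    f =ᵐ[volume.restrict (Icc 0 T)] g := by
  rw [← restrict_Ioo_eq_restrict_Icc]
  have hf' : IntervalIntegrable f volume 0 T :=
    (intervalIntegrable_iff_integrableOn_Icc_of_le hT).2 hf
  have hg' : IntervalIntegrable g volume 0 T :=
    (intervalIntegrable_iff_integrableOn_Icc_of_le hT).2 hg
  filter_upwards [ae_restrict_of_ae hf'.ae_hasDerivAt_integral,
    ae_restrict_of_ae hg'.ae_hasDerivAt_integral, ae_restrict_mem measurableSet_Ioo]
    with t htf htg ht
  rw [uIcc_of_le hT] at htf htg
  have h0 : (0 : ℝ) ∈ Icc 0 T := left_mem_Icc.2 hT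
  have hd := htf (Ioo_subset_Icc_self ht) 0 h0
  refine hd.unique ((htg (Ioo_subset_Icc_self ht) 0 h0).congr_of_eventuallyEq ?_)
  filter_upwards [Icc_mem_nhds ht.1 ht.2] with s hs using h s hs

/-- Weak compactness in a weighted `L²` space: a pointwise limit of functions with uniformly
bounded weighted energy has a density obeying the same bound. -/
theorem exists_density_of_tendsto {ι : Type*} (F : Filter ι) [F.NeBot] {T : ℝ} {W : ℝ → ℝ}
    (hW : ContinuousOn W (Icc 0 T)) (hWpos : ∀ t ∈ Icc 0 T, 0 < W t) {C : ENNReal} (hC : C ≠ ⊤)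
    {ψ g : ι → ℝ → ℝ} {φ : ℝ → ℝ} (hg : ∀ i, IntegrableOn (g i) (Icc 0 T))
    (hψ : ∀ i, ∀ t ∈ Icc 0 T, ψ i t = ψ i 0 + ∫ s in (0 : ℝ)..t, g i s)
    (hE : ∀ i, ∫⁻ t in Icc 0 T, ENNReal.ofReal (g i t ^ 2) / ENNReal.ofReal (W t) ≤ C)
    (hlim : ∀ t ∈ Icc 0 T, Tendsto (fun i => ψ i t) F (𝓝 (φ t))) :
    ∃ f : ℝ → ℝ, IntegrableOn f (Icc 0 T) ∧
      (∀ t ∈ Icc 0 T, φ t = φ 0 + ∫ s in (0 : ℝ)..t, f s) ∧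
      ∫⁻ t in Icc 0 T, ENNReal.ofReal (f t ^ 2) / ENNReal.ofReal (W t) ≤ C := by
  set μ := volume.restrict (Icc (0 : ℝ) T) with hμ
  have hmem : ∀ᵐ t ∂μ, t ∈ Icc 0 T := ae_restrict_mem measurableSet_Icc
  have hr : ContinuousOn (fun t => √(W t)) (Icc 0 T) := hW.sqrt
  have hrm : AEStronglyMeasurable (fun t => √(W t)) μ :=
    hr.aestronglyMeasurable measurableSet_Icc
  have hr2 : MemLp (fun t => √(W t)) 2 μ := by
    obtain ⟨B, hB⟩ := isCompact_Icc.exists_bound_of_continuousOn hr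
    exact MemLp.of_bound hrm B (hmem.mono hB)
  have hsq : ∀ t ∈ Icc 0 T, ∀ a : ℝ, ENNReal.ofReal ((a / √(W t)) ^ 2) =
      ENNReal.ofReal (a ^ 2) / ENNReal.ofReal (W t) := fun t ht a => by
    rw [div_pow, Real.sq_sqrt (hWpos t ht).le, ENNReal.ofReal_div_of_pos (hWpos t ht)]
  have hEq : ∀ i, ∫⁻ t, ENNReal.ofReal ((g i t / √(W t)) ^ 2) ∂μ =
      ∫⁻ t, ENNReal.ofReal (g i t ^ 2) / ENNReal.ofReal (W t) ∂μ := fun i =>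
    lintegral_congr_ae (hmem.mono fun t ht => hsq t ht _)
  have hu2 : ∀ i, MemLp (fun t => g i t / √(W t)) 2 μ := fun i => by
    have hm : AEStronglyMeasurable (fun t => g i t / √(W t)) μ :=
      ((hg i).aemeasurable.div hrm.aemeasurable).aestronglyMeasurable
    rw [memLp_two_iff_integrable_sq hm]
    refine ⟨hm.pow 2, ?_⟩
    rw [hasFiniteIntegral_iff_ofReal (Eventually.of_forall fun t => sq_nonneg _), hEq]
    exact (hE i).trans_lt hC.lt_top
  let u : ι → Lp ℝ 2 μ := fun i => (hu2 i).toLp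
  have hu : ∀ i, ‖u i‖ ≤ √C.toReal := fun i => by
    refine Real.le_sqrt_of_sq_le ?_
    rw [← ENNReal.ofReal_le_iff_le_toReal hC, ← lintegral_ofReal_sq_eq]
    refine le_trans (le_of_eq ?_) (hE i)
    rw [← hEq]
    exact lintegral_congr_ae ((hu2 i).coeFn_toLp.mono fun t ht => by simp only [u, ht])
  obtain ⟨U, hUF, x, hx, hxv⟩ := exists_ultrafilter_tendsto_inner F u hu
  have hpair : ∀ t ∈ Icc 0 T, ∀ (y : Lp ℝ 2 μ) (k : ℝ → ℝ),
      (∀ᵐ s ∂μ, y s * √(W s) = k s) →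
      inner (E := Lp ℝ 2 μ) ℝ y ((hr2.indicator (measurableSet_Icc (a := 0) (b := t))).toLp) =
        ∫ s in (0 : ℝ)..t, k s := by
    intro t ht y k hk
    have hres : volume.restrict (Icc 0 t) = μ.restrict (Icc 0 t) := by
      rw [hμ, Measure.restrict_restrict measurableSet_Icc,
        inter_eq_left.2 (Icc_subset_Icc_right ht.2)]
    rw [L2.inner_def, intervalIntegral.integral_of_le ht.1, ← integral_Icc_eq_integral_Ioc,
      hres, ← integral_indicator (μ := μ) (f := k) measurableSet_Icc]
    refine integral_congr_ae ?_
    filter_upwards [hk, (hr2.indicator (measurableSet_Icc (a := 0) (b := t))).coeFn_toLp]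
      with s hs hs'
    rw [hs']
    by_cases h : s ∈ Icc 0 t
    · simp [indicator_of_mem h, ← hs, mul_comm]
    · simp [indicator_of_notMem h]
  refine ⟨fun t => x t * √(W t), (Lp.memLp x).integrable_mul hr2, fun t ht => ?_, ?_⟩
  · have h1 := hxv ((hr2.indicator (measurableSet_Icc (a := 0) (b := t))).toLp)
    rw [hpair t ht x _ (Eventually.of_forall fun _ => rfl)] at h1
    have h2 : ∀ i, inner ℝ (u i) ((hr2.indicator (measurableSet_Icc (a := 0) (b := t))).toLp) =
        ψ i t - ψ i 0 := fun i => by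
      rw [hpair t ht (u i) (g i), hψ i t ht, add_sub_cancel_left]
      filter_upwards [(hu2 i).coeFn_toLp, hmem] with s hs hs'
      rw [show u i s = _ from hs, div_mul_cancel₀ _ (Real.sqrt_pos.2 (hWpos s hs')).ne']
    simp only [h2] at h1
    have h0 : (0 : ℝ) ∈ Icc 0 T := ⟨le_rfl, ht.1.trans ht.2⟩
    have := tendsto_nhds_unique h1 (((hlim t ht).sub (hlim 0 h0)).mono_left hUF)
    linarith
  · calc _ = ∫⁻ t, ENNReal.ofReal (x t ^ 2) ∂μ := by
          refine lintegral_congr_ae (hmem.mono fun t ht => ?_)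
          simp only
          rw [← hsq t ht, mul_div_cancel_right₀ _ (Real.sqrt_pos.2 (hWpos t ht)).ne']
      _ = ENNReal.ofReal (‖x‖ ^ 2) := lintegral_ofReal_sq_eq x
      _ ≤ C := by
          rw [ENNReal.ofReal_le_iff_le_toReal hC, ← Real.sq_sqrt ENNReal.toReal_nonneg]
          exact pow_le_pow_left₀ (norm_nonneg _) hx 2

/-- Removing a vanishing regularization of the denominator (Fatou's lemma). -/
theorem lintegral_div_le_of_forall_add {α : Type*} [MeasurableSpace α] {μ : Measure α}
    {a b : α → ℝ} (ha : AEMeasurable a μ) (hb : AEMeasurable b μ) {C : ENNReal}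
    (h : ∀ δ > 0, ∫⁻ t, ENNReal.ofReal (a t) / ENNReal.ofReal (b t + δ) ∂μ ≤ C) :
    ∫⁻ t, ENNReal.ofReal (a t) / ENNReal.ofReal (b t) ∂μ ≤ C := by
  have hlim : ∀ t, Tendsto
      (fun n : ℕ => ENNReal.ofReal (a t) / ENNReal.ofReal (b t + 1 / ((n : ℝ) + 1))) atTop
      (𝓝 (ENNReal.ofReal (a t) / ENNReal.ofReal (b t))) := fun t => by
    refine ENNReal.Tendsto.const_div (ENNReal.tendsto_ofReal ?_) (Or.inl ENNReal.ofReal_ne_top)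
    simpa using (tendsto_one_div_add_atTop_nhds_zero_nat (𝕜 := ℝ)).const_add (b t)
  calc _ = ∫⁻ t, liminf (fun n : ℕ =>
            ENNReal.ofReal (a t) / ENNReal.ofReal (b t + 1 / ((n : ℝ) + 1))) atTop ∂μ :=
          lintegral_congr fun t => (hlim t).liminf_eq.symm
    _ ≤ liminf (fun n : ℕ => ∫⁻ t,
            ENNReal.ofReal (a t) / ENNReal.ofReal (b t + 1 / ((n : ℝ) + 1)) ∂μ) atTop :=
          lintegral_liminf_le' fun n =>
            ha.ennreal_ofReal.div (hb.add_const _).ennreal_ofReal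
    _ ≤ C := by
          refine liminf_le_of_frequently_le' (Frequently.of_forall fun n => h _ ?_)
          positivity

theorem continuousOn_of_eq_primitive {T : ℝ} {f g : ℝ → ℝ} (hg : IntegrableOn g (Icc 0 T))
    (h : ∀ t ∈ Icc 0 T, f t = f 0 + ∫ s in (0 : ℝ)..t, g s) : ContinuousOn f (Icc 0 T) := by
  refine ContinuousOn.congr (continuousOn_const.add ?_) h
  rcases le_or_gt 0 T with hT | hT
  · rw [← uIcc_of_le hT] at hg ⊢
    exact intervalIntegral.continuousOn_primitive_interval hg
  · simp [Icc_eq_empty hT.not_ge]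

/-- Composition with a continuous function preserves uniform convergence to a continuous limit
on a compact interval. -/
theorem tendstoUniformlyOn_comp_of_continuous {ι : Type*} {F : Filter ι} {T : ℝ} {b : ℝ → ℝ}
    (hb : Continuous b) {ψ : ι → ℝ → ℝ} {φ : ℝ → ℝ} (hφ : ContinuousOn φ (Icc 0 T))
    (h : TendstoUniformlyOn ψ φ F (Icc 0 T)) :
    TendstoUniformlyOn (fun i t => b (ψ i t)) (fun t => b (φ t)) F (Icc 0 T) := by
  obtain ⟨R, hR⟩ := isCompact_Icc.exists_bound_of_continuousOn hφ
  refine UniformContinuousOn.comp_tendstoUniformlyOn_eventually (s := Metric.closedBall 0 (R + 1))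
    ?_ (fun t ht => ?_)
    ((isCompact_closedBall 0 (R + 1)).uniformContinuousOn_of_continuous hb.continuousOn) h
  · filter_upwards [Metric.tendstoUniformlyOn_iff.1 h 1 one_pos] with i hi t ht
    have h1 := hi t ht
    have h2 := hR t ht
    rw [dist_comm] at h1
    rw [mem_closedBall_zero_iff]
    calc ‖ψ i t‖ = ‖(ψ i t - φ t) + φ t‖ := by rw [sub_add_cancel]
      _ ≤ ‖ψ i t - φ t‖ + ‖φ t‖ := norm_add_le _ _
      _ ≤ R + 1 := by rw [dist_eq_norm] at h1; linarith
  · rw [mem_closedBall_zero_iff]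
    linarith [hR t ht]

theorem exists_density_of_energy_lt {B2 : ℝ → ℝ} {T : ℝ} {φ : ℝ → ℝ} {M : ENNReal}
    (h : energy B2 T φ < M) :
    ∃ g : ℝ → ℝ, IntegrableOn g (Icc 0 T) ∧
      (∀ t ∈ Icc 0 T, φ t = φ 0 + ∫ s in (0 : ℝ)..t, g s) ∧
      ∫⁻ t in Icc 0 T, ENNReal.ofReal (g t ^ 2) / ENNReal.ofReal (B2 (φ t)) ≤ 2 * M := by
  unfold energy at h
  split_ifs at h with hex
  · refine ⟨hex.choose, hex.choose_spec.1, hex.choose_spec.2, ?_⟩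
    calc _ = 2 * ((1 / 2) * ∫⁻ t in Icc 0 T,
          ENNReal.ofReal (hex.choose t ^ 2) / ENNReal.ofReal (B2 (φ t))) := by
            rw [← mul_assoc, one_div, ENNReal.mul_inv_cancel two_ne_zero ENNReal.ofNat_ne_top,
              one_mul]
      _ ≤ 2 * M := by gcongr
  · exact absurd h not_top_lt

/-- Lemma "semic", single-edge version. If `B² : ℝ → [0,∞)`
is locally Lipschitz, then the functional `S` is lower semicontinuous with
respect to uniform convergence on `[0,T]`: whenever `φ⁽ˡ⁾ → φ` uniformly on
`[0,T]`, one has `S(φ) ≤ liminf_l S(φ⁽ˡ⁾)`. -/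
theorem energy_lower_semicontinuous
    (B2 : ℝ → ℝ) (hB2nonneg : ∀ h : ℝ, 0 ≤ B2 h) (hB2 : LocallyLipschitz B2)
    (T : ℝ) (hT : 0 < T) (φl : ℕ → ℝ → ℝ) (φ : ℝ → ℝ)
    (hconv : TendstoUniformlyOn (fun l t => φl l t) φ atTop (Icc 0 T)) :
    energy B2 T φ ≤ liminf (fun l => energy B2 T (φl l)) atTop := by
  refine le_of_forall_gt_imp_ge_of_dense fun M hM => ?_
  rcases eq_or_ne M ⊤ with rfl | hMtop
  · exact le_top
  obtain ⟨n, hn, hlt⟩ := extraction_of_frequently_atTop (frequently_lt_of_liminf_lt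
    isCobounded_ge_of_top hM)
  choose g hg hprim hE using fun i => exists_density_of_energy_lt (hlt i)
  have hconv' : TendstoUniformlyOn (fun i => φl (n i)) φ atTop (Icc 0 T) :=
    fun v hv => hn.tendsto_atTop.eventually (hconv v hv)
  have hφ : ContinuousOn φ (Icc 0 T) := hconv'.continuousOn
    (Frequently.of_forall fun i => continuousOn_of_eq_primitive (hg i) (hprim i))
  have hb : ContinuousOn (fun t => B2 (φ t)) (Icc 0 T) := hB2.continuous.comp_continuousOn hφ
  have key : ∀ δ > 0, ∃ f : ℝ → ℝ, IntegrableOn f (Icc 0 T) ∧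
      (∀ t ∈ Icc 0 T, φ t = φ 0 + ∫ s in (0 : ℝ)..t, f s) ∧
      ∫⁻ t in Icc 0 T, ENNReal.ofReal (f t ^ 2) / ENNReal.ofReal (B2 (φ t) + δ) ≤ 2 * M := by
    intro δ hδ
    obtain ⟨N, hN⟩ := eventually_atTop.1 (Metric.tendstoUniformlyOn_iff.1
      (tendstoUniformlyOn_comp_of_continuous hB2.continuous hφ hconv') δ hδ)
    refine exists_density_of_tendsto atTop (ψ := fun i => φl (n (i + N)))
      (g := fun i => g (i + N)) (hb.add continuousOn_const)
      (fun t _ => add_pos_of_nonneg_of_pos (hB2nonneg _) hδ)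
      (ENNReal.mul_ne_top ENNReal.ofNat_ne_top hMtop) (fun i => hg _) (fun i => hprim _)
      (fun i => le_trans (setLIntegral_mono' measurableSet_Icc fun t ht => ?_) (hE (i + N)))
      (fun t ht => (tendsto_add_atTop_iff_nat N).2 (hconv'.tendsto_at ht))
    have h1 := hN (i + N) (Nat.le_add_left _ _) t ht
    rw [dist_comm, Real.dist_eq] at h1
    gcongr
    rw [Pi.add_apply]
    linarith [(abs_lt.1 h1).2]
  have hex : ∃ f : ℝ → ℝ, IntegrableOn f (Icc 0 T) ∧
      ∀ t ∈ Icc 0 T, φ t = φ 0 + ∫ s in (0 : ℝ)..t, f s := by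
    obtain ⟨f, hf, hf', -⟩ := key 1 one_pos
    exact ⟨f, hf, hf'⟩
  rw [energy, dif_pos hex]
  have hle : ∫⁻ t in Icc 0 T,
      ENNReal.ofReal (hex.choose t ^ 2) / ENNReal.ofReal (B2 (φ t)) ≤ 2 * M := by
    refine lintegral_div_le_of_forall_add (hex.choose_spec.1.aemeasurable.pow_const 2)
      (hb.aemeasurable measurableSet_Icc) fun δ hδ => ?_
    obtain ⟨f, hf, hf', hfE⟩ := key δ hδ
    have hae := ae_eq_of_integral_eq hT.le hex.choose_spec.1 hf fun t ht =>
      add_left_cancel ((hex.choose_spec.2 t ht).symm.trans (hf' t ht))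
    refine le_trans (le_of_eq (lintegral_congr_ae ?_)) hfE
    filter_upwards [hae] with t ht
    rw [ht]
  calc _ ≤ 1 / 2 * (2 * M) := by gcongr
    _ = M := by
      rw [← mul_assoc, one_div, ENNReal.inv_mul_cancel two_ne_zero ENNReal.ofNat_ne_top, one_mul]
end

section
/- Suppose B² : ℝ → [0,∞) is locally Lipschitz continuous and bounded, say B²(h) ≤ M₃ for all h ∈ ℝ. Then for every s ≥ 0, δ ≥ 0 and h₀ ∈ ℝ, the level set Φ_δ(s) = { φ ∈ C([0,T], ℝ) : |φ(0) − h₀| ≤ δ and S(φ) ≤ s } is compact in C([0,T], ℝ); moreover every φ ∈ Φ_δ(s) satisfies |φ(t+h) − φ(t)| ≤ √(2 s M₃) · √h for all 0 ≤ t ≤ t + h ≤ T. -/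
open MeasureTheory Set Filter Classical

/-- The action functional on the space `C([0,T], ℝ)` of continuous maps,
obtained by extending an element of `C([0,T], ℝ)` to `ℝ` (constant outside
`[0,T]`) and applying `energy`. -/
noncomputable def energyC (B2 : ℝ → ℝ) (T : ℝ) (hT : (0:ℝ) ≤ T)
    (φ : C(Icc (0:ℝ) T, ℝ)) : ENNReal :=
  energy B2 T (IccExtend hT φ)

open scoped ENNReal Topology

lemma ENNReal.div_le_liminf_div {ι : Type*} {l : Filter ι} {d e : ι → ℝ≥0∞} {x y : ℝ≥0∞}
    (hd : Tendsto d l (𝓝 x)) (he : Tendsto e l (𝓝 y)) (hx : x ≠ ⊤) :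
    x / y ≤ liminf (fun i => d i / e i) l := by
  rcases eq_or_ne x 0 with rfl | hx0
  · simp
  rcases l.eq_or_neBot with rfl | hl
  · simp
  exact (ENNReal.Tendsto.div hd (Or.inl hx0) he (Or.inr hx)).liminf_eq.ge

lemma lintegral_div_le_of_tendsto {α : Type*} [MeasurableSpace α] {μ : Measure α}
    {d e : ℕ → α → ℝ≥0∞} {d' e' : α → ℝ≥0∞} {C : ℝ≥0∞}
    (hdm : ∀ n, Measurable (d n)) (hem : ∀ n, Measurable (e n))
    (hd : ∀ᵐ x ∂μ, Tendsto (fun n => d n x) atTop (𝓝 (d' x)))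
    (he : ∀ᵐ x ∂μ, Tendsto (fun n => e n x) atTop (𝓝 (e' x)))
    (hd' : ∀ x, d' x ≠ ⊤)
    (hC : ∀ n, ∫⁻ x, d n x / e n x ∂μ ≤ C) :
    ∫⁻ x, d' x / e' x ∂μ ≤ C := by
  calc ∫⁻ x, d' x / e' x ∂μ
      ≤ ∫⁻ x, liminf (fun n => d n x / e n x) atTop ∂μ := by
        refine lintegral_mono_ae ?_
        filter_upwards [hd, he] with x hdx hex
        exact ENNReal.div_le_liminf_div hdx hex (hd' x)
    _ ≤ liminf (fun n => ∫⁻ x, d n x / e n x ∂μ) atTop :=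
        lintegral_liminf_le fun n => (hdm n).div (hem n)
    _ ≤ C := by
        refine (liminf_le_liminf (Eventually.of_forall hC)).trans ?_
        simp

lemma sq_lintegral_enorm_le {α : Type*} [MeasurableSpace α] {μ : Measure α}
    {g : α → ℝ} {q r : α → ℝ≥0∞} (hq : Measurable q) (hr : Measurable r)
    (h : ∀ x, ‖g x‖ₑ ^ 2 ≤ q x * r x) :
    (∫⁻ x, ‖g x‖ₑ ∂μ) ^ 2 ≤ (∫⁻ x, q x ∂μ) * ∫⁻ x, r x ∂μ := by
  have sq (z : ℝ≥0∞) : (z ^ (1 / 2 : ℝ)) ^ 2 = z := by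
    rw [← ENNReal.rpow_natCast, ← ENNReal.rpow_mul]; norm_num
  have key : ∫⁻ x, ‖g x‖ₑ ∂μ ≤ (∫⁻ x, q x ∂μ) ^ (1 / 2 : ℝ) * (∫⁻ x, r x ∂μ) ^ (1 / 2 : ℝ) := by
    have := ENNReal.lintegral_mul_le_Lp_mul_Lq μ Real.HolderConjugate.two_two
      (hq.pow_const (1 / 2 : ℝ)).aemeasurable (hr.pow_const (1 / 2 : ℝ)).aemeasurable
    simp only [ENNReal.rpow_ofNat, sq] at this
    refine (lintegral_mono fun x => ?_).trans this
    rw [← ENNReal.pow_le_pow_left_iff two_ne_zero, Pi.mul_apply, mul_pow, sq, sq]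
    exact h x
  calc _ ≤ _ := pow_le_pow_left' key 2
    _ = _ := by rw [mul_pow, sq, sq]

lemma exists_density_of_energyC_le {B2 : ℝ → ℝ} (hB2 : Continuous B2)
    (hB2nonneg : ∀ h : ℝ, 0 ≤ B2 h) {T : ℝ} (hT : 0 ≤ T) {s : ℝ} {φ : C(Icc (0:ℝ) T, ℝ)}
    (hφ : energyC B2 T hT φ ≤ ENNReal.ofReal s) :
    ∃ (g : ℝ → ℝ) (q : ℝ → ℝ≥0∞), Integrable g ∧ Measurable q ∧
      ∫⁻ t, q t ≤ 2 * ENNReal.ofReal s ∧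
      (∀ t, ‖g t‖ₑ ^ 2 ≤ q t * ENNReal.ofReal (B2 (IccExtend hT φ t))) ∧
      ∀ a b, IccExtend hT φ b - IccExtend hT φ a = ∫ t in a..b, g t := by
  set ψ := IccExtend hT φ with hψ
  have hψc : Continuous ψ := φ.continuous.Icc_extend'
  unfold energyC energy at hφ
  rw [← hψ] at hφ
  split_ifs at hφ with h
  swap
  · simp at hφ
  obtain ⟨hgi, hgφ⟩ := h.choose_spec
  generalize h.choose = g₀ at *
  have hI : ∫⁻ t in Icc 0 T, ENNReal.ofReal (g₀ t ^ 2) / ENNReal.ofReal (B2 (ψ t)) ≤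
      2 * ENNReal.ofReal s := by
    calc _ = 2 * (1 / 2 * ∫⁻ t in Icc 0 T, ENNReal.ofReal (g₀ t ^ 2) /
          ENNReal.ofReal (B2 (ψ t))) := by
            rw [← mul_assoc, one_div, ENNReal.mul_inv_cancel two_ne_zero ENNReal.ofNat_ne_top,
              one_mul]
      _ ≤ _ := by gcongr
  replace hI := (lintegral_mono_set Ioc_subset_Icc_self).trans hI
  replace hgi := hgi.mono_set Ioc_subset_Icc_self
  have hgm := hgi.aestronglyMeasurable
  have hbm : Measurable fun t => B2 (ψ t) := (hB2.comp hψc).measurable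
  set g₁ := hgm.mk g₀ with hg₁
  have hg₁m : Measurable g₁ := hgm.stronglyMeasurable_mk.measurable
  have hZ : MeasurableSet {t | B2 (ψ t) ≠ 0} := hbm (measurableSet_singleton 0).compl
  set g := (Ioc 0 T ∩ {t | B2 (ψ t) ≠ 0}).indicator g₁ with hg
  have hgmeas : Measurable g := hg₁m.indicator (measurableSet_Ioc.inter hZ)
  have hae : g =ᵐ[volume.restrict (Ioc 0 T)] g₀ := by
    have hfin : ∀ᵐ t ∂volume.restrict (Ioc 0 T),
        ENNReal.ofReal (g₀ t ^ 2) / ENNReal.ofReal (B2 (ψ t)) < ⊤ := by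
      refine ae_lt_top' ?_ (hI.trans_lt (by finiteness)).ne
      exact ((hgm.aemeasurable.pow_const 2).ennreal_ofReal).div hbm.ennreal_ofReal.aemeasurable
    filter_upwards [hfin, hgm.ae_eq_mk, ae_restrict_mem measurableSet_Ioc] with t h1 h2 h3
    by_cases hb : B2 (ψ t) = 0
    · have hgt : g t = 0 := by simp [hg, hb]
      rw [hgt]
      by_contra hne
      rw [hb, ENNReal.ofReal_zero, ENNReal.div_zero] at h1
      · exact lt_irrefl _ h1
      · rw [ne_eq, ENNReal.ofReal_eq_zero, not_le]
        exact sq_pos_of_ne_zero (Ne.symm hne)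
    · rw [hg, indicator_of_mem (mem_inter h3 hb), h2]
  have hg0 : ∀ t ∉ Ioc 0 T, g t = 0 := fun t ht => indicator_of_notMem (fun h => ht h.1) _
  have hgint : Integrable g :=
    (hgi.congr_fun_ae hae.symm).integrable_of_forall_notMem_eq_zero hg0
  have hprim : ∀ t, ψ t = ψ 0 + ∫ u in (0:ℝ)..t, g u := by
    have hmid : ∀ t ∈ Icc 0 T, ψ t = ψ 0 + ∫ u in (0:ℝ)..t, g u := by
      intro t ht
      rw [hgφ t ht, intervalIntegral.integral_of_le ht.1, intervalIntegral.integral_of_le ht.1]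
      congr 1
      exact integral_congr_ae
        (ae_restrict_of_ae_restrict_of_subset (Ioc_subset_Ioc_right ht.2) hae.symm)
    have hzero : ∀ a b, a ≤ b → (b ≤ 0 ∨ T ≤ a) → ∫ u in a..b, g u = 0 := by
      intro a b hab hb
      rw [intervalIntegral.integral_of_le hab]
      refine setIntegral_eq_zero_of_forall_eq_zero fun x hx => hg0 x fun hx' => ?_
      rcases hb with hb | hb
      · linarith [hx.2, hx'.1]
      · linarith [hx.1, hx'.2]
    intro t
    rcases le_total t 0 with h0 | h0
    · rw [intervalIntegral.integral_symm, hzero t 0 h0 (Or.inl le_rfl), hψ,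
        IccExtend_of_le_left _ _ h0, IccExtend_left]
      simp
    rcases le_total t T with h1 | h1
    · exact hmid t ⟨h0, h1⟩
    · rw [← intervalIntegral.integral_add_adjacent_intervals (b := T) hgint.intervalIntegrable
        hgint.intervalIntegrable, hzero T t h1 (Or.inr le_rfl), add_zero,
        ← hmid T ⟨hT, le_rfl⟩, hψ, IccExtend_of_right_le _ _ h1, IccExtend_right]
  refine ⟨g, fun t => ENNReal.ofReal (g t ^ 2) / ENNReal.ofReal (B2 (ψ t)), hgint,
    (hgmeas.pow_const 2).ennreal_ofReal.div hbm.ennreal_ofReal, ?_, fun t => ?_, fun a b => ?_⟩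
  · rw [← setLIntegral_eq_of_support_subset (s := Ioc 0 T)]
    · refine (lintegral_congr_ae ?_).trans_le hI
      filter_upwards [hae] with t ht
      rw [ht]
    · intro t ht
      by_contra hn
      exact ht (by simp [hg0 t hn])
  · by_cases hb : B2 (ψ t) = 0
    · have : g t = 0 := by simp [hg, hb]
      simp [this]
    · rw [ENNReal.div_mul_cancel]
      · rw [Real.enorm_eq_ofReal_abs, ← ENNReal.ofReal_pow (abs_nonneg _), sq_abs]
      · simpa using lt_of_le_of_ne (hB2nonneg _) (Ne.symm hb)
      · simp
  · rw [hprim b, hprim a, add_sub_add_left_eq_sub]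
    exact intervalIntegral.integral_interval_sub_left hgint.intervalIntegrable
      hgint.intervalIntegrable

/-- The average of `f` over the interval from `t` to `t + h`. -/
noncomputable def shiftAverage (f : ℝ → ℝ≥0∞) (h t : ℝ) : ℝ≥0∞ :=
  ∫⁻ v in Ioc (0:ℝ) 1, f (t + h * v)

lemma measurable_shiftAverage {f : ℝ → ℝ≥0∞} (hf : Measurable f) (h : ℝ) :
    Measurable (shiftAverage f h) := by
  have : Measurable fun p : ℝ × ℝ => f (p.1 + h * p.2) := by fun_prop
  exact this.lintegral_prod_right'

lemma lintegral_shiftAverage {f : ℝ → ℝ≥0∞} (hf : Measurable f) (h : ℝ) :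
    ∫⁻ t, shiftAverage f h t = ∫⁻ t, f t := by
  unfold shiftAverage
  rw [lintegral_lintegral_swap (by fun_prop)]
  simp [lintegral_add_right_eq_self]

lemma tendsto_shiftAverage {f : ℕ → ℝ → ℝ≥0∞} {f' : ℝ → ℝ≥0∞} {h : ℕ → ℝ} {h' t : ℝ} {M : ℝ≥0∞}
    (hM : M ≠ ⊤) (hf : ∀ n, Measurable (f n)) (hfM : ∀ n x, f n x ≤ M)
    (hlim : ∀ v, Tendsto (fun n => f n (t + h n * v)) atTop (𝓝 (f' (t + h' * v)))) :
    Tendsto (fun n => shiftAverage (f n) (h n) t) atTop (𝓝 (shiftAverage f' h' t)) := by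
  refine tendsto_lintegral_of_dominated_convergence (fun _ => M) (fun n => ?_) (fun n => ?_) ?_ ?_
  · have := hf n
    fun_prop
  · exact Eventually.of_forall fun v => hfM n _
  · simp [hM]
  · exact Eventually.of_forall hlim

lemma lintegral_sq_slope_div_shiftAverage_le {ψ g : ℝ → ℝ} {q r : ℝ → ℝ≥0∞}
    (hq : Measurable q) (hr : Measurable r)
    (hgq : ∀ t, ‖g t‖ₑ ^ 2 ≤ q t * r t) (hψ : ∀ a b, ψ b - ψ a = ∫ t in a..b, g t)
    {h : ℝ} (hh : h ≠ 0) :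
    ∫⁻ t, ‖(ψ (t + h) - ψ t) / h‖ₑ ^ 2 / shiftAverage r h t ≤ ∫⁻ t, q t := by
  rw [← lintegral_shiftAverage hq h]
  refine lintegral_mono fun t => ENNReal.div_le_of_le_mul ?_
  have : (ψ (t + h) - ψ t) / h = ∫ v in Ioc (0:ℝ) 1, g (t + h * v) := by
    rw [hψ, ← intervalIntegral.integral_of_le zero_le_one,
      intervalIntegral.integral_comp_add_mul _ hh]
    simp [div_eq_inv_mul]
  rw [this]
  calc _ ≤ (∫⁻ v in Ioc (0:ℝ) 1, ‖g (t + h * v)‖ₑ) ^ 2 :=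
        pow_le_pow_left' (enorm_integral_le_lintegral_enorm _) 2
    _ ≤ _ := sq_lintegral_enorm_le (by fun_prop) (by fun_prop) fun v => hgq _

open AbsolutelyContinuousOnInterval in
lemma sq_sum_dist_le {ψ g : ℝ → ℝ} {q r : ℝ → ℝ≥0∞} {C M : ℝ} (hC : 0 ≤ C) (hM : 0 ≤ M)
    (hq : Measurable q) (hr : Measurable r) (hqC : ∫⁻ t, q t ≤ ENNReal.ofReal C)
    (hrM : ∀ t, r t ≤ ENNReal.ofReal M)
    (hgq : ∀ t, ‖g t‖ₑ ^ 2 ≤ q t * r t) (hψ : ∀ a b, ψ b - ψ a = ∫ t in a..b, g t)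
    {a b : ℝ} {E : ℕ × (ℕ → ℝ × ℝ)} (hE : E ∈ disjWithin a b) :
    (∑ i ∈ Finset.range E.1, dist (ψ (E.2 i).1) (ψ (E.2 i).2)) ^ 2 ≤
      C * (M * ∑ i ∈ Finset.range E.1, dist (E.2 i).1 (E.2 i).2) := by
  set U := ⋃ i ∈ Finset.range E.1, uIoc (E.2 i).1 (E.2 i).2
  have h1 : ENNReal.ofReal (∑ i ∈ Finset.range E.1, dist (ψ (E.2 i).1) (ψ (E.2 i).2)) ≤
      ∫⁻ t in U, ‖g t‖ₑ := by
    rw [ENNReal.ofReal_sum_of_nonneg fun _ _ => dist_nonneg,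
      lintegral_biUnion_finset hE.2 fun _ _ => measurableSet_uIoc]
    refine Finset.sum_le_sum fun i _ => ?_
    rw [dist_comm, Real.dist_eq, hψ, intervalIntegral.abs_integral_eq_abs_integral_uIoc,
      ← Real.enorm_eq_ofReal_abs]
    exact enorm_integral_le_lintegral_enorm _
  have h2 : volume U ≤ ENNReal.ofReal (∑ i ∈ Finset.range E.1, dist (E.2 i).1 (E.2 i).2) := by
    rw [ENNReal.ofReal_sum_of_nonneg fun _ _ => dist_nonneg]
    refine (measure_biUnion_finset_le _ _).trans (Finset.sum_le_sum fun i _ => ?_)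
    rw [Real.volume_uIoc, dist_comm, Real.dist_eq]
  rw [← ENNReal.ofReal_le_ofReal_iff (mul_nonneg hC (mul_nonneg hM
      (Finset.sum_nonneg fun _ _ => dist_nonneg))),
    ENNReal.ofReal_pow (Finset.sum_nonneg fun _ _ => dist_nonneg), ENNReal.ofReal_mul hC,
    ENNReal.ofReal_mul hM]
  calc _ ≤ (∫⁻ t in U, ‖g t‖ₑ) ^ 2 := pow_le_pow_left' h1 2
    _ ≤ (∫⁻ t in U, q t) * ∫⁻ t in U, r t := sq_lintegral_enorm_le hq hr hgq
    _ ≤ _ := by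
      refine mul_le_mul' ((setLIntegral_le_lintegral _ _).trans hqC) ?_
      calc ∫⁻ t in U, r t ≤ ∫⁻ _ in U, ENNReal.ofReal M := lintegral_mono hrM
        _ = ENNReal.ofReal M * volume U := by simp
        _ ≤ _ := by gcongr

open AbsolutelyContinuousOnInterval in
lemma absolutelyContinuousOnInterval_of_sq_sum_dist_le {ψ : ℝ → ℝ} {a b K : ℝ} (hK : 0 ≤ K)
    (h : ∀ E ∈ disjWithin a b, (∑ i ∈ Finset.range E.1, dist (ψ (E.2 i).1) (ψ (E.2 i).2)) ^ 2 ≤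
      K * ∑ i ∈ Finset.range E.1, dist (E.2 i).1 (E.2 i).2) :
    AbsolutelyContinuousOnInterval ψ a b := by
  rw [absolutelyContinuousOnInterval_iff]
  intro ε hε
  refine ⟨ε ^ 2 / (K + 1), by positivity, fun E hE hlt => ?_⟩
  refine lt_of_pow_lt_pow_left₀ 2 hε.le ?_
  have h3 : 0 ≤ ∑ i ∈ Finset.range E.1, dist (E.2 i).1 (E.2 i).2 :=
    Finset.sum_nonneg fun _ _ => dist_nonneg
  rw [lt_div_iff₀ (by positivity)] at hlt
  nlinarith [h E hE]

/-- If `ψ` is absolutely continuous on `[0,T]`, then any bound on the difference-quotient energies of `ψ`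
bounds its energy. -/
lemma energy_le_of_lintegral_sq_slope_le {B2 : ℝ → ℝ} (hB2 : Continuous B2)
    {M T : ℝ} (hM : ∀ h, B2 h ≤ M) (hT : 0 ≤ T) {ψ : ℝ → ℝ} (hψ : Continuous ψ)
    (hac : AbsolutelyContinuousOnInterval ψ 0 T) {C : ℝ≥0∞}
    (hC : ∀ h : ℝ, 0 < h → ∫⁻ t, ‖(ψ (t + h) - ψ t) / h‖ₑ ^ 2 /
      shiftAverage (fun x => ENNReal.ofReal (B2 (ψ x))) h t ≤ 2 * C) :
    energy B2 T ψ ≤ C := by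
  have hex : ∃ g : ℝ → ℝ, IntegrableOn g (Icc 0 T) ∧
      ∀ t ∈ Icc 0 T, ψ t = ψ 0 + ∫ s in (0:ℝ)..t, g s := by
    refine ⟨deriv ψ, ?_, fun t ht => ?_⟩
    · rw [← intervalIntegrable_iff_integrableOn_Icc_of_le hT]
      exact hac.intervalIntegrable_deriv
    · rw [(hac.mono (uIcc_subset_uIcc_left (by rwa [uIcc_of_le hT]))).integral_deriv_eq_sub]
      ring
  unfold energy
  rw [dif_pos hex]
  obtain ⟨hgi, hgψ⟩ := hex.choose_spec
  generalize hex.choose = g at *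
  have hder : ∀ᵐ t ∂volume.restrict (Icc 0 T), HasDerivAt ψ (g t) t := by
    have hgi' : IntervalIntegrable g volume 0 T := by
      rwa [intervalIntegrable_iff_integrableOn_Icc_of_le hT]
    rw [← restrict_Ioo_eq_restrict_Icc, ae_restrict_iff' measurableSet_Ioo]
    filter_upwards [hgi'.ae_hasDerivAt_integral] with t ht htI
    rw [uIcc_of_le hT] at ht
    refine ((ht (Ioo_subset_Icc_self htI) 0 (left_mem_Icc.2 hT)).const_add
      (ψ 0)).congr_of_eventuallyEq ?_
    filter_upwards [Icc_mem_nhds htI.1 htI.2] with u hu using hgψ u hu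
  let η : ℕ → ℝ := fun n => 1 / ((n : ℝ) + 1)
  have hη : ∀ n, 0 < η n := fun n => Nat.one_div_pos_of_nat
  have hη0 : Tendsto η atTop (𝓝 0) := tendsto_one_div_add_atTop_nhds_zero_nat
  have hbm : Measurable fun x => ENNReal.ofReal (B2 (ψ x)) :=
    (hB2.comp hψ).measurable.ennreal_ofReal
  have hint : ∫⁻ t in Icc 0 T, ENNReal.ofReal (g t ^ 2) / ENNReal.ofReal (B2 (ψ t)) ≤ 2 * C := by
    refine lintegral_div_le_of_tendsto (d := fun n t => ‖(ψ (t + η n) - ψ t) / η n‖ₑ ^ 2)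
      (e := fun n => shiftAverage (fun x => ENNReal.ofReal (B2 (ψ x))) (η n))
      (fun n => ?_) (fun n => measurable_shiftAverage hbm _) ?_ ?_ (fun _ => ENNReal.ofReal_ne_top)
      (fun n => (setLIntegral_le_lintegral _ _).trans (hC _ (hη n)))
    · have := hψ.measurable
      fun_prop
    · filter_upwards [hder] with t ht
      have hs : Tendsto (fun n => (ψ (t + η n) - ψ t) / η n) atTop (𝓝 (g t)) := by
        have := (hasDerivAt_iff_tendsto_slope_zero.1 ht).comp
          (tendsto_nhdsWithin_iff.2 ⟨hη0, Eventually.of_forall fun n => (hη n).ne'⟩)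
        refine this.congr fun n => ?_
        simp [div_eq_inv_mul]
      have : ENNReal.ofReal (g t ^ 2) = ‖g t‖ₑ ^ 2 := by
        rw [Real.enorm_eq_ofReal_abs, ← ENNReal.ofReal_pow (abs_nonneg _), sq_abs]
      rw [this]
      exact ENNReal.Tendsto.pow hs.enorm
    · refine Eventually.of_forall fun t => ?_
      have h0 : ENNReal.ofReal (B2 (ψ t)) =
          shiftAverage (fun x => ENNReal.ofReal (B2 (ψ x))) 0 t := by
        simp [shiftAverage]
      rw [h0]
      refine tendsto_shiftAverage (f := fun _ x => ENNReal.ofReal (B2 (ψ x)))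
        (M := ENNReal.ofReal M) ENNReal.ofReal_ne_top (fun _ => hbm)
        (fun _ x => ENNReal.ofReal_le_ofReal (hM _)) fun v => ?_
      have hc : Continuous fun x => ENNReal.ofReal (B2 (ψ x)) :=
        ENNReal.continuous_ofReal.comp (hB2.comp hψ)
      exact (hc.tendsto _).comp (tendsto_const_nhds.add (hη0.mul_const v))
  calc _ ≤ 1 / 2 * (2 * C) := by gcongr
    _ = C := by
      rw [← mul_assoc, one_div, ENNReal.inv_mul_cancel two_ne_zero ENNReal.ofNat_ne_top, one_mul]

open AbsolutelyContinuousOnInterval in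
lemma sq_sum_dist_le_of_energyC_le {B2 : ℝ → ℝ} (hB2 : Continuous B2)
    (hB2nonneg : ∀ h : ℝ, 0 ≤ B2 h) {M : ℝ} (hM : ∀ h, B2 h ≤ M) {T : ℝ} (hT : 0 ≤ T)
    {s : ℝ} (hs : 0 ≤ s) {φ : C(Icc (0:ℝ) T, ℝ)} (hφ : energyC B2 T hT φ ≤ ENNReal.ofReal s)
    {a b : ℝ} {E : ℕ × (ℕ → ℝ × ℝ)} (hE : E ∈ disjWithin a b) :
    (∑ i ∈ Finset.range E.1, dist (IccExtend hT φ (E.2 i).1) (IccExtend hT φ (E.2 i).2)) ^ 2 ≤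
      2 * s * M * ∑ i ∈ Finset.range E.1, dist (E.2 i).1 (E.2 i).2 := by
  obtain ⟨g, q, -, hq, hqs, hgq, hψ⟩ := exists_density_of_energyC_le hB2 hB2nonneg hT hφ
  rw [mul_assoc (2 * s)]
  refine sq_sum_dist_le (by positivity) ((hB2nonneg 0).trans (hM 0)) hq
    (hB2.comp φ.continuous.Icc_extend').measurable.ennreal_ofReal (hqs.trans_eq ?_)
    (fun t => ENNReal.ofReal_le_ofReal (hM _)) hgq hψ hE
  rw [ENNReal.ofReal_mul zero_le_two]
  simp

lemma dist_le_of_energyC_le {B2 : ℝ → ℝ} (hB2 : Continuous B2)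
    (hB2nonneg : ∀ h : ℝ, 0 ≤ B2 h) {M : ℝ} (hM : ∀ h, B2 h ≤ M) {T : ℝ} (hT : 0 ≤ T)
    {s : ℝ} (hs : 0 ≤ s) {φ : C(Icc (0:ℝ) T, ℝ)} (hφ : energyC B2 T hT φ ≤ ENNReal.ofReal s)
    (x y : Icc (0:ℝ) T) : dist (φ x) (φ y) ≤ √(2 * s * M) * √(dist x y) := by
  have hM0 : 0 ≤ M := (hB2nonneg 0).trans (hM 0)
  have h := sq_sum_dist_le_of_energyC_le hB2 hB2nonneg hM hT hs hφ (a := 0) (b := T)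
    (E := (1, fun _ => (x, y))) ⟨fun _ _ => by simp [uIcc_of_le hT],
      by simp⟩
  simp only [Finset.range_one, Finset.sum_singleton, IccExtend_val] at h
  rw [← Real.sqrt_mul (by positivity)]
  exact Real.le_sqrt_of_sq_le h

lemma isClosed_setOf_energyC_le {B2 : ℝ → ℝ} (hB2 : Continuous B2)
    (hB2nonneg : ∀ h : ℝ, 0 ≤ B2 h) {M : ℝ} (hM : ∀ h, B2 h ≤ M) {T : ℝ} (hT : 0 ≤ T)
    {s : ℝ} (hs : 0 ≤ s) :
    IsClosed {φ : C(Icc (0:ℝ) T, ℝ) | energyC B2 T hT φ ≤ ENNReal.ofReal s} := by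
  refine IsSeqClosed.isClosed fun φ φ' hφ hlim => ?_
  have hM0 : 0 ≤ M := (hB2nonneg 0).trans (hM 0)
  have hpt : ∀ t, Tendsto (fun n => IccExtend hT (φ n) t) atTop (𝓝 (IccExtend hT φ' t)) :=
    fun t => ((continuous_eval_const (F := C(Icc (0:ℝ) T, ℝ)) (projIcc 0 T hT t)).tendsto φ').comp
      hlim
  have hcont : ∀ φ : C(Icc (0:ℝ) T, ℝ), Continuous (IccExtend hT φ) :=
    fun φ => φ.continuous.Icc_extend'
  have hbm : ∀ φ : C(Icc (0:ℝ) T, ℝ),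
      Measurable fun x => ENNReal.ofReal (B2 (IccExtend hT φ x)) :=
    fun φ => (hB2.comp (hcont φ)).measurable.ennreal_ofReal
  refine energy_le_of_lintegral_sq_slope_le hB2 hM hT (hcont φ') ?_ fun h hh => ?_
  · refine absolutelyContinuousOnInterval_of_sq_sum_dist_le (K := 2 * s * M) (by positivity)
      fun E hE => ?_
    refine le_of_tendsto ((tendsto_finsetSum _ fun i _ => (hpt _).dist (hpt _)).pow 2)
      (Eventually.of_forall fun n =>
        sq_sum_dist_le_of_energyC_le hB2 hB2nonneg hM hT hs (hφ n) hE)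
  · refine lintegral_div_le_of_tendsto
      (d := fun n t => ‖(IccExtend hT (φ n) (t + h) - IccExtend hT (φ n) t) / h‖ₑ ^ 2)
      (e := fun n => shiftAverage (fun x => ENNReal.ofReal (B2 (IccExtend hT (φ n) x))) h)
      (fun n => ?_) (fun n => measurable_shiftAverage (hbm _) _) ?_ ?_ (fun _ => by finiteness)
      (fun n => ?_)
    · have := (hcont (φ n)).measurable
      fun_prop
    · exact Eventually.of_forall fun t =>
        ENNReal.Tendsto.pow (((hpt _).sub (hpt _)).div_const h).enorm
    · exact Eventually.of_forall fun t =>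
        tendsto_shiftAverage (h := fun _ => h) (M := ENNReal.ofReal M) ENNReal.ofReal_ne_top
          (fun n => hbm (φ n)) (fun _ x => ENNReal.ofReal_le_ofReal (hM _)) fun v =>
          ENNReal.tendsto_ofReal ((hB2.tendsto _).comp (hpt _))
    · obtain ⟨g, q, -, hq, hqs, hgq, hψ⟩ := exists_density_of_energyC_le hB2 hB2nonneg hT (hφ n)
      exact (lintegral_sq_slope_div_shiftAverage_le hq (hbm _) hgq hψ hh.ne').trans hqs

lemma isCompact_setOf_dist_le_mul_sqrt {T : ℝ} (x₀ : Icc (0:ℝ) T) (h0 δ K : ℝ) :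
    IsCompact {φ : C(Icc (0:ℝ) T, ℝ) | |φ x₀ - h0| ≤ δ ∧
      ∀ x y, dist (φ x) (φ y) ≤ K * √(dist x y)} := by
  apply ArzelaAscoli.isCompact_of_equicontinuous
  · set F : Set (Icc (0:ℝ) T → ℝ) := {f | |f x₀ - h0| ≤ δ ∧
      ∀ x y, dist (f x) (f y) ≤ K * √(dist x y)}
    have hF : IsCompact F := by
      refine (isCompact_univ_pi fun x => isCompact_closedBall h0
        (δ + K * √(dist x x₀))).of_isClosed_subset ?_ fun f hf x _ => ?_
      · have h1 : IsClosed {f : Icc (0:ℝ) T → ℝ | |f x₀ - h0| ≤ δ} :=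
          isClosed_le (by fun_prop) continuous_const
        have h2 : IsClosed (⋂ (x) (y),
            {f : Icc (0:ℝ) T → ℝ | dist (f x) (f y) ≤ K * √(dist x y)}) :=
          isClosed_iInter fun x => isClosed_iInter fun y =>
            isClosed_le (by fun_prop) continuous_const
        convert h1.inter h2 using 1
        ext f
        simp only [F, mem_inter_iff, mem_iInter, mem_ofPred_eq]
      · have h1 := hf.1
        have h2 := hf.2 x x₀
        rw [← Real.dist_eq] at h1
        rw [Metric.mem_closedBall]
        linarith [dist_triangle (f x) (f x₀) h0]
    convert hF using 1
    ext f
    refine ⟨?_, fun hf => ?_⟩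
    · rintro ⟨φ, hφ, rfl⟩
      exact hφ
    · refine ⟨⟨f, ?_⟩, hf, rfl⟩
      refine continuous_iff_continuousAt.2 fun x => tendsto_iff_dist_tendsto_zero.2 ?_
      refine squeeze_zero (fun _ => dist_nonneg) (fun y => hf.2 y x) ?_
      have : Continuous fun y => K * √(dist y x) := by fun_prop
      simpa using this.tendsto x
  · refine Metric.equicontinuous_of_continuity_modulus (fun d => K * √d) ?_ _
      fun x y φ => φ.2.2 x y
    have : Continuous fun d => K * √d := by fun_prop
    simpa using this.tendsto 0

/-- Theorem "compactness", single-edge version. Suppose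
`B² : ℝ → [0,∞)` is locally Lipschitz and bounded by `M₃`.  Then for every
`s ≥ 0`, `δ ≥ 0`, `h₀ ∈ ℝ`, the level set
`Φ_δ(s) = {φ ∈ C([0,T],ℝ) : |φ(0) - h₀| ≤ δ, S(φ) ≤ s}` is compact in
`C([0,T],ℝ)`, and every `φ ∈ Φ_δ(s)` satisfies
`|φ(t+h) - φ(t)| ≤ √(2sM₃)·√h` whenever `0 ≤ t ≤ t + h ≤ T`. -/
theorem level_sets_compact
    (B2 : ℝ → ℝ) (hB2nonneg : ∀ h : ℝ, 0 ≤ B2 h) (hB2 : LocallyLipschitz B2)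
    (M3 : ℝ) (hM3 : ∀ h : ℝ, B2 h ≤ M3)
    (T : ℝ) (hT : 0 < T) (s δ h0 : ℝ) (hs : 0 ≤ s) (hδ : 0 ≤ δ) :
    IsCompact {φ : C(Icc (0:ℝ) T, ℝ) |
        |φ ⟨0, left_mem_Icc.mpr hT.le⟩ - h0| ≤ δ ∧
        energyC B2 T hT.le φ ≤ ENNReal.ofReal s} ∧
    ∀ φ : C(Icc (0:ℝ) T, ℝ),
      |φ ⟨0, left_mem_Icc.mpr hT.le⟩ - h0| ≤ δ →
      energyC B2 T hT.le φ ≤ ENNReal.ofReal s →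
      ∀ (t h : ℝ) (htt : 0 ≤ t) (hh : 0 ≤ h) (hth : t + h ≤ T),
        |φ ⟨t + h, ⟨add_nonneg htt hh, hth⟩⟩ -
            φ ⟨t, ⟨htt, le_trans (le_add_of_nonneg_right hh) hth⟩⟩| ≤
          Real.sqrt (2 * s * M3) * Real.sqrt h := by
  refine ⟨?_, fun φ _ hφ t h htt hh hth => ?_⟩
  · refine (isCompact_setOf_dist_le_mul_sqrt ⟨0, left_mem_Icc.mpr hT.le⟩ h0 δ
      (√(2 * s * M3))).of_isClosed_subset ?_ fun φ hφ =>
        ⟨hφ.1, dist_le_of_energyC_le hB2.continuous hB2nonneg hM3 hT.le hs hφ.2⟩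
    have hball : IsClosed {φ : C(Icc (0:ℝ) T, ℝ) | |φ ⟨0, left_mem_Icc.mpr hT.le⟩ - h0| ≤ δ} :=
      isClosed_le (by fun_prop) continuous_const
    exact hball.inter
      (isClosed_setOf_energyC_le hB2.continuous hB2nonneg hM3 hT.le hs)
  · have := dist_le_of_energyC_le hB2.continuous hB2nonneg hM3 hT.le hs hφ
      ⟨t + h, ⟨add_nonneg htt hh, hth⟩⟩ ⟨t, ⟨htt, le_trans (le_add_of_nonneg_right hh) hth⟩⟩
    simpa [Subtype.dist_eq, Real.dist_eq, abs_of_nonneg hh] using this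
end

section
/- For all μ > 0 and ν ∈ (−l, l) with μ² > ν², the partial derivative of T with respect to μ satisfies |∂T/∂μ (μ,ν)| ≤ M̄ [ πμ/√(μ² − ν²) + μ/((μ² − ν²)√(1 + μ² − ν²)) + |ν|/(μ² − ν²) ]. -/
open MeasureTheory Set

/-- The exit-time function near a saddle point:
`T(μ,ν) = (1/2)∫_ν^l g(√(y² + μ² - ν²), y)/√(y² + μ² - ν²) dy`,
where `g` plays the role of `det J_ψ`. -/
noncomputable def Tfun (g : ℝ × ℝ → ℝ) (l μ ν : ℝ) : ℝ :=
  (1 / 2) * ∫ y in ν..l,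
    g (Real.sqrt (y ^ 2 + μ ^ 2 - ν ^ 2), y) / Real.sqrt (y ^ 2 + μ ^ 2 - ν ^ 2)

/-- The derivative in `μ` of the integrand defining `Tfun`. -/
noncomputable def TfunIntegrandDeriv (g : ℝ × ℝ → ℝ) (ν μ y : ℝ) : ℝ :=
  (fderiv ℝ g (Real.sqrt (y ^ 2 + μ ^ 2 - ν ^ 2), y) (1, 0) *
      (μ / Real.sqrt (y ^ 2 + μ ^ 2 - ν ^ 2)) * Real.sqrt (y ^ 2 + μ ^ 2 - ν ^ 2) -
    g (Real.sqrt (y ^ 2 + μ ^ 2 - ν ^ 2), y) * (μ / Real.sqrt (y ^ 2 + μ ^ 2 - ν ^ 2))) /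
    Real.sqrt (y ^ 2 + μ ^ 2 - ν ^ 2) ^ 2

theorem hasDerivAt_Tfun_integrand {g : ℝ × ℝ → ℝ} {ν μ y : ℝ} (hg : Differentiable ℝ g)
    (h : 0 < y ^ 2 + μ ^ 2 - ν ^ 2) :
    HasDerivAt (fun m => g (Real.sqrt (y ^ 2 + m ^ 2 - ν ^ 2), y) /
      Real.sqrt (y ^ 2 + m ^ 2 - ν ^ 2)) (TfunIntegrandDeriv g ν μ y) μ := by
  have hs : HasDerivAt (fun m : ℝ => Real.sqrt (y ^ 2 + m ^ 2 - ν ^ 2))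
      (μ / Real.sqrt (y ^ 2 + μ ^ 2 - ν ^ 2)) μ := by
    have h1 : HasDerivAt (fun m : ℝ => y ^ 2 + m ^ 2 - ν ^ 2) (2 * μ) μ := by
      simpa using ((hasDerivAt_pow 2 μ).const_add (y ^ 2)).sub_const (ν ^ 2)
    convert h1.sqrt h.ne' using 1
    rw [mul_div_mul_left _ _ two_ne_zero]
  have hc : HasDerivAt (fun m : ℝ => g (Real.sqrt (y ^ 2 + m ^ 2 - ν ^ 2), y))
      (fderiv ℝ g (Real.sqrt (y ^ 2 + μ ^ 2 - ν ^ 2), y)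
        (μ / Real.sqrt (y ^ 2 + μ ^ 2 - ν ^ 2), 0)) μ :=
    (hg _).hasFDerivAt.comp_hasDerivAt μ (hs.prodMk (hasDerivAt_const μ y))
  have hlin : ((μ / Real.sqrt (y ^ 2 + μ ^ 2 - ν ^ 2), 0) : ℝ × ℝ) =
      (μ / Real.sqrt (y ^ 2 + μ ^ 2 - ν ^ 2)) • ((1, 0) : ℝ × ℝ) := by simp
  rw [hlin, map_smul, smul_eq_mul, mul_comm] at hc
  exact hc.div hs (Real.sqrt_pos.2 h).ne'

theorem abs_TfunIntegrandDeriv_le {g : ℝ × ℝ → ℝ} {M ν μ y : ℝ}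
    (hgb : ∀ p, |g p| ≤ M) (hgd : ∀ p, ‖fderiv ℝ g p‖ ≤ M) (hμ : 0 ≤ μ)
    (h : 0 < y ^ 2 + μ ^ 2 - ν ^ 2) :
    |TfunIntegrandDeriv g ν μ y| ≤ M * μ *
      (1 / (y ^ 2 + μ ^ 2 - ν ^ 2) + 1 / Real.sqrt (y ^ 2 + μ ^ 2 - ν ^ 2) ^ 3) := by
  have hs2 : y ^ 2 + μ ^ 2 - ν ^ 2 = Real.sqrt (y ^ 2 + μ ^ 2 - ν ^ 2) ^ 2 :=
    (Real.sq_sqrt h.le).symm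
  have hs : 0 < Real.sqrt (y ^ 2 + μ ^ 2 - ν ^ 2) := Real.sqrt_pos.2 h
  have hA : |fderiv ℝ g (Real.sqrt (y ^ 2 + μ ^ 2 - ν ^ 2), y) (1, 0)| ≤ M := by
    have h1 := (fderiv ℝ g (Real.sqrt (y ^ 2 + μ ^ 2 - ν ^ 2), y)).le_opNorm (1, 0)
    have h2 : ‖((1, 0) : ℝ × ℝ)‖ = 1 := by simp [Prod.norm_def]
    rw [h2, mul_one] at h1
    exact h1.trans (hgd _)
  have hB := hgb (Real.sqrt (y ^ 2 + μ ^ 2 - ν ^ 2), y)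
  unfold TfunIntegrandDeriv
  rw [show (1 / (y ^ 2 + μ ^ 2 - ν ^ 2) : ℝ) =
    1 / Real.sqrt (y ^ 2 + μ ^ 2 - ν ^ 2) ^ 2 by rw [← hs2]]
  generalize fderiv ℝ g (Real.sqrt (y ^ 2 + μ ^ 2 - ν ^ 2), y) (1, 0) = A at *
  generalize g (Real.sqrt (y ^ 2 + μ ^ 2 - ν ^ 2), y) = B at *
  generalize Real.sqrt (y ^ 2 + μ ^ 2 - ν ^ 2) = s at *
  have e : (A * (μ / s) * s - B * (μ / s)) / s ^ 2 =
      A * (μ * (1 / s ^ 2)) - B * (μ * (1 / s ^ 3)) := by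
    field_simp
  rw [e]
  calc _ ≤ |A * (μ * (1 / s ^ 2))| + |B * (μ * (1 / s ^ 3))| := abs_sub _ _
    _ = |A| * (μ * (1 / s ^ 2)) + |B| * (μ * (1 / s ^ 3)) := by
      rw [abs_mul A, abs_mul B, abs_of_nonneg (by positivity : 0 ≤ μ * (1 / s ^ 2)),
        abs_of_nonneg (by positivity : 0 ≤ μ * (1 / s ^ 3))]
    _ ≤ M * (μ * (1 / s ^ 2)) + M * (μ * (1 / s ^ 3)) := by gcongr
    _ = _ := by ring

theorem continuous_TfunIntegrandDeriv {g : ℝ × ℝ → ℝ} {ν μ : ℝ} (hg : ContDiff ℝ 1 g)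
    (h : ν ^ 2 < μ ^ 2) : Continuous (TfunIntegrandDeriv g ν μ) := by
  have hs : ∀ y : ℝ, Real.sqrt (y ^ 2 + μ ^ 2 - ν ^ 2) ≠ 0 := fun y =>
    (Real.sqrt_pos.2 (by nlinarith [sq_nonneg y])).ne'
  have hsc : Continuous fun y : ℝ => Real.sqrt (y ^ 2 + μ ^ 2 - ν ^ 2) := by fun_prop
  have hp : Continuous fun y : ℝ => (Real.sqrt (y ^ 2 + μ ^ 2 - ν ^ 2), y) :=
    hsc.prodMk continuous_id
  have hA : Continuous fun y : ℝ =>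
      fderiv ℝ g (Real.sqrt (y ^ 2 + μ ^ 2 - ν ^ 2), y) (1, 0) :=
    ((hg.continuous_fderiv one_ne_zero).comp hp).clm_apply continuous_const
  have hd : Continuous fun y : ℝ => μ / Real.sqrt (y ^ 2 + μ ^ 2 - ν ^ 2) :=
    continuous_const.div hsc hs
  exact (((hA.mul hd).mul hsc).sub ((hg.continuous.comp hp).mul hd)).div (hsc.pow 2)
    fun y => pow_ne_zero 2 (hs y)

theorem continuous_Tfun_integrand {g : ℝ × ℝ → ℝ} {ν μ : ℝ} (hg : Continuous g)
    (h : ν ^ 2 < μ ^ 2) :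
    Continuous fun y : ℝ => g (Real.sqrt (y ^ 2 + μ ^ 2 - ν ^ 2), y) /
      Real.sqrt (y ^ 2 + μ ^ 2 - ν ^ 2) :=
  (hg.comp (by fun_prop)).div (by fun_prop) fun y =>
    (Real.sqrt_pos.2 (by nlinarith [sq_nonneg y])).ne'

open scoped Topology in
theorem hasDerivAt_Tfun {g : ℝ × ℝ → ℝ} {M l μ ν : ℝ} (hg : ContDiff ℝ 1 g)
    (hgb : ∀ p, |g p| ≤ M) (hgd : ∀ p, ‖fderiv ℝ g p‖ ≤ M)
    (hμ : 0 < μ) (hμν : ν ^ 2 < μ ^ 2) :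
    HasDerivAt (fun μ' => Tfun g l μ' ν)
      ((1 / 2) * ∫ y in ν..l, TfunIntegrandDeriv g ν μ y) μ := by
  have hM : 0 ≤ M := (abs_nonneg _).trans (hgb 0)
  obtain ⟨r, hνr, hrμ⟩ := exists_between (abs_lt_of_sq_lt_sq hμν hμ.le)
  have hr : 0 < r := (abs_nonneg ν).trans_lt hνr
  have hc : 0 < r ^ 2 - ν ^ 2 := by
    have := sq_lt_sq' (by linarith [abs_nonneg ν]) hνr
    rw [sq_abs] at this
    linarith
  have hlow : ∀ m ∈ Ioo r (μ + 1), ∀ y : ℝ, r ^ 2 - ν ^ 2 ≤ y ^ 2 + m ^ 2 - ν ^ 2 := by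
    intro m hm y
    nlinarith [hm.1, sq_nonneg y]
  have hlow' : ∀ m ∈ Ioo r (μ + 1), ν ^ 2 < m ^ 2 := by
    intro m hm
    nlinarith [hm.1]
  have hnhds : Ioo r (μ + 1) ∈ 𝓝 μ := Ioo_mem_nhds hrμ (by linarith)
  have key := intervalIntegral.hasDerivAt_integral_of_dominated_loc_of_deriv_le
    (μ := volume) (a := ν) (b := l)
    (F := fun m y => g (Real.sqrt (y ^ 2 + m ^ 2 - ν ^ 2), y) /
      Real.sqrt (y ^ 2 + m ^ 2 - ν ^ 2))
    (F' := TfunIntegrandDeriv g ν) (x₀ := μ)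
    (bound := fun _ => M * (μ + 1) *
      (1 / (r ^ 2 - ν ^ 2) + 1 / Real.sqrt (r ^ 2 - ν ^ 2) ^ 3))
    hnhds
    (Filter.mem_of_superset hnhds fun m hm =>
      (continuous_Tfun_integrand hg.continuous (hlow' m hm)).aestronglyMeasurable)
    ((continuous_Tfun_integrand hg.continuous hμν).intervalIntegrable _ _)
    (continuous_TfunIntegrandDeriv hg hμν).aestronglyMeasurable
    (Filter.Eventually.of_forall fun y _ m hm => by
      have h1 := hlow m hm y
      have hm0 : 0 ≤ m := (hr.trans hm.1).le
      refine (abs_TfunIntegrandDeriv_le hgb hgd hm0 (hc.trans_le h1)).trans ?_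
      have hs := Real.sqrt_pos.2 hc
      have hpos := hc.trans_le h1
      gcongr
      exact hm.2.le)
    intervalIntegrable_const
    (Filter.Eventually.of_forall fun y _ m hm =>
      hasDerivAt_Tfun_integrand (hg.differentiable one_ne_zero) (hc.trans_le (hlow m hm y)))
  exact key.2.const_mul _

theorem integral_inv_add_inv_sqrt_pow_three {a b c : ℝ} (ha : 0 < a) :
    ∫ y in b..c, (1 / (y ^ 2 + a ^ 2) + 1 / Real.sqrt (y ^ 2 + a ^ 2) ^ 3) =
      (Real.arctan (c / a) - Real.arctan (b / a)) / a +
        (c / Real.sqrt (c ^ 2 + a ^ 2) - b / Real.sqrt (b ^ 2 + a ^ 2)) / a ^ 2 := by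
  have hd : ∀ y : ℝ, HasDerivAt
      (fun y => Real.arctan (y / a) / a + y / Real.sqrt (y ^ 2 + a ^ 2) / a ^ 2)
      (1 / (y ^ 2 + a ^ 2) + 1 / Real.sqrt (y ^ 2 + a ^ 2) ^ 3) y := by
    intro y
    have hp : 0 < y ^ 2 + a ^ 2 := by positivity
    have hs := Real.sqrt_pos.2 hp
    have h1 : HasDerivAt (fun y : ℝ => y ^ 2 + a ^ 2) (2 * y) y := by
      simpa using (hasDerivAt_pow 2 y).add_const (a ^ 2)
    have h2 := (((hasDerivAt_id y).div_const a).arctan.div_const a).add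
      (((hasDerivAt_id y).div (h1.sqrt hp.ne') hs.ne').div_const (a ^ 2))
    refine h2.congr_deriv ?_
    have hsq := Real.sq_sqrt hp.le
    simp only [id]
    congr 1
    · field_simp
      ring
    · generalize Real.sqrt (y ^ 2 + a ^ 2) = s at *
      field_simp
      linarith
  have hcont : Continuous fun y : ℝ =>
      1 / (y ^ 2 + a ^ 2) + 1 / Real.sqrt (y ^ 2 + a ^ 2) ^ 3 :=
    (continuous_const.div (by fun_prop) fun y => by positivity).add
      (continuous_const.div (by fun_prop) fun y => by positivity)
  rw [intervalIntegral.integral_eq_sub_of_hasDerivAt (fun y _ => hd y)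
    (hcont.intervalIntegrable _ _)]
  ring

theorem div_sqrt_sq_add_sq_le {a l : ℝ} (ha : 0 < a) (hl0 : 0 ≤ l) (hl1 : l ≤ 1) :
    l / Real.sqrt (l ^ 2 + a ^ 2) ≤ 1 / Real.sqrt (1 + a ^ 2) := by
  rw [div_le_div_iff₀ (by positivity) (by positivity), one_mul]
  apply Real.le_sqrt_of_sq_le
  rw [mul_pow, Real.sq_sqrt (by positivity)]
  nlinarith [mul_nonneg (sq_nonneg a) (by nlinarith : 0 ≤ 1 - l ^ 2)]

/-- estimate \eqref{derv1}. Fix `l ∈ (0,1)`, `M̄ > 0`, and a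
`C¹` function `g` with `|g| ≤ M̄` and `|∇g| ≤ M̄`.  For all `μ > 0`,
`ν ∈ (-l, l)` with `μ² > ν²`:
`|∂T/∂μ(μ,ν)| ≤ M̄[πμ/√(μ²-ν²) + μ/((μ²-ν²)√(1+μ²-ν²)) + |ν|/(μ²-ν²)]`. -/
theorem Tfun_deriv_mu_bound
    (l M : ℝ) (hl0 : 0 < l) (hl1 : l < 1) (hM : 0 < M)
    (g : ℝ × ℝ → ℝ) (hg : ContDiff ℝ 1 g)
    (hgb : ∀ p, |g p| ≤ M) (hgd : ∀ p, ‖fderiv ℝ g p‖ ≤ M)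
    (μ ν : ℝ) (hμ : 0 < μ) (hν : ν ∈ Ioo (-l) l) (hμν : ν ^ 2 < μ ^ 2) :
    ∃ D : ℝ, HasDerivAt (fun μ' => Tfun g l μ' ν) D μ ∧
      |D| ≤ M * (Real.pi * μ / Real.sqrt (μ ^ 2 - ν ^ 2) +
        μ / ((μ ^ 2 - ν ^ 2) * Real.sqrt (1 + μ ^ 2 - ν ^ 2)) +
        |ν| / (μ ^ 2 - ν ^ 2)) := by
  refine ⟨_, hasDerivAt_Tfun hg hgb hgd hμ hμν, ?_⟩
  have ha2 : 0 < μ ^ 2 - ν ^ 2 := by linarith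
  obtain ⟨a, ha, hae⟩ : ∃ a : ℝ, 0 < a ∧ μ ^ 2 - ν ^ 2 = a ^ 2 :=
    ⟨_, Real.sqrt_pos.2 ha2, (Real.sq_sqrt ha2.le).symm⟩
  have hadd : ∀ y : ℝ, y ^ 2 + μ ^ 2 - ν ^ 2 = y ^ 2 + a ^ 2 := fun y => by linarith
  have hcont : Continuous fun y : ℝ => M * μ *
      (1 / (y ^ 2 + a ^ 2) + 1 / Real.sqrt (y ^ 2 + a ^ 2) ^ 3) :=
    continuous_const.mul ((continuous_const.div (by fun_prop) fun y => by positivity).add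
      (continuous_const.div (by fun_prop) fun y => by positivity))
  have hint : |∫ y in ν..l, TfunIntegrandDeriv g ν μ y| ≤ ∫ y in ν..l, M * μ *
      (1 / (y ^ 2 + a ^ 2) + 1 / Real.sqrt (y ^ 2 + a ^ 2) ^ 3) := by
    rw [← Real.norm_eq_abs]
    refine intervalIntegral.norm_integral_le_of_norm_le hν.2.le
      (Filter.Eventually.of_forall fun y _ => ?_) (hcont.intervalIntegrable _ _)
    have hpos : 0 < y ^ 2 + μ ^ 2 - ν ^ 2 := by rw [hadd]; positivity
    simpa only [hadd, Real.norm_eq_abs] using abs_TfunIntegrandDeriv_le hgb hgd hμ.le hpos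
  rw [intervalIntegral.integral_const_mul, integral_inv_add_inv_sqrt_pow_three ha,
    show ν ^ 2 + a ^ 2 = μ ^ 2 by linarith, Real.sqrt_sq hμ.le] at hint
  have hone : 1 + μ ^ 2 - ν ^ 2 = 1 + a ^ 2 := by linarith
  rw [hone, hae, Real.sqrt_sq ha.le]
  have harctan : Real.arctan (l / a) - Real.arctan (ν / a) ≤ Real.pi := by
    linarith [Real.arctan_lt_pi_div_two (l / a), Real.neg_pi_div_two_lt_arctan (ν / a)]
  have hend : l / Real.sqrt (l ^ 2 + a ^ 2) - ν / μ ≤ 1 / Real.sqrt (1 + a ^ 2) + |ν| / μ := by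
    have h1 : -(ν / μ) ≤ |ν| / μ := by
      rw [← neg_div]
      gcongr
      exact neg_le_abs ν
    linarith [div_sqrt_sq_add_sq_le ha hl0.le hl1.le]
  rw [abs_mul, abs_of_pos (by norm_num : (0 : ℝ) < 1 / 2)]
  calc _ ≤ |∫ y in ν..l, TfunIntegrandDeriv g ν μ y| := by
        linarith [abs_nonneg (∫ y in ν..l, TfunIntegrandDeriv g ν μ y)]
    _ ≤ M * μ * (Real.pi / a + (1 / Real.sqrt (1 + a ^ 2) + |ν| / μ) / a ^ 2) := by
        refine hint.trans ?_
        gcongr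
    _ = _ := by
        have : Real.sqrt (1 + a ^ 2) ≠ 0 := (Real.sqrt_pos.2 (by positivity)).ne'
        field_simp
        ring
end
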